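/- Call $\ell:(0,\infty)\to(0,\infty)$ slowly varying if it is measurable, bounded above and below by positive constants on each compact subset of $(0,\infty)$, and $\lim_{x\to\infty}\ell(\lambda x)/\ell(x)=1$ for every $\lambda>0$. Let $(Y,\mu)$ be a probability space, $F:Y\to Y$ a measure-preserving map, and $\varphi:Y\to\{1,2,3,\dots\}$ a measurable function with $\mu(\varphi>n)=\ell(n)n^{-\beta}$ for all $n\ge1$, where $\ell$ is slowly varying and $\beta\in(0,\tfrac12)$. Let $R:L^1(Y,\mu)\to L^1(Y,\mu)$ be the transfer operator of $F$, characterized by $\int_Y (Rv)\,w\,d\mu=\int_Y v\,(w\circ F)\,d\mu$ for all $v\in L^1(Y,\mu)$, $w\in L^\infty(Y,\mu)$, and put $R_nv=R(1_{\{\varphi=n\}}v)$ for $n\ge1$. Let $\mathcal B\subset L^\infty(Y,\mu)$ be a linear subspace that contains the constant functions and is a complex Banach space for a norm $\|\cdot\|_{\mathcal B}$ with $\|v\|_{L^\infty}\le\|v\|_{\mathcal B}$ for all $v\in\mathcal B$. Assume: (H1) each $R_n$ maps $\mathcal B$ boundedly into $\mathcal B$, and there is a constant $C>0$ with $\|R_n\|_{\mathcal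 B}\le C\mu(\varphi=n)$ for all $n\ge1$; hence $R(z)=\sum_{n\ge1}z^nR_n$ is a bounded operator on $\mathcal B$ for every $z\in\mathbb C$ with $|z|\le1$, and $R(1)=R$ on $\mathcal B$; (H2) (i) $1$ is a simple isolated eigenvalue of $R(1)$ on $\mathcal B$, that is, $1$ is an eigenvalue and an isolated point of the spectrum of $R(1)$, and its algebraic multiplicity is one: the spectral projection $\frac{1}{2\pi i}\oint_{|\zeta-1|=r}(\zeta-R(1))^{-1}\,d\zeta$ has rank one, where $r>0$ is such that $1$ is the only point of the spectrum of $R(1)$ in $\{|\zeta-1|\le r\}$; (ii) for every $z\in\mathbb C$ with $|z|\le1$ and $z\ne1$, $1$ does not belong to the spectrum of $R(z)$ on $\mathcal B$. Define the renewal operators $T_n:\mathcal B\to\mathcal B$ by $T_0=I$ and $T_n=\sum_{j=1}^nT_{n-j}R_j$ for $n\ge1$. Then there is a constant $C'>0$ such that $$\|T_n\|_{\mathcal B}\le C'\,\ell(n)\,n^{-\beta}\qquad\text{for all }n\ge1 .$$ -/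

import Mathlib

open MeasureTheory Filter Topology
open scoped ENNReal

noncomputable section

/-- `l : (0,∞) → (0,∞)` is slowly varying: it is measurable, bounded above and below by positive
constants on each compact subset of `(0,∞)`, and `l (c x) / l x → 1` as `x → ∞` for every `c > 0`.
Only the values of `l` on `(0,∞)` matter. -/
def SlowlyVarying (l : ℝ → ℝ) : Prop :=
  (∀ x : ℝ, 0 < x → 0 < l x) ∧
  Measurable (fun x : Set.Ioi (0 : ℝ) => l x) ∧
  (∀ K : Set ℝ, IsCompact K → K ⊆ Set.Ioi 0 →
    ∃ a b : ℝ, 0 < a ∧ ∀ x ∈ K, a ≤ l x ∧ l x ≤ b) ∧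
  ∀ c : ℝ, 0 < c → Tendsto (fun x => l (c * x) / l x) atTop (𝓝 1)

section Transfer

variable {Y : Type*} [MeasurableSpace Y]

/-- `R : L¹ → L¹` is the transfer operator of `F`: `∫ (R v) w dμ = ∫ v (w ∘ F) dμ` for all
`v ∈ L¹` and `w ∈ L^∞`. -/
def IsTransferOperator (μ : Measure Y) (F : Y → Y) (R : Lp ℂ 1 μ →L[ℂ] Lp ℂ 1 μ) : Prop :=
  ∀ (v : Lp ℂ 1 μ) (w : Lp ℂ ∞ μ), ∫ y, R v y * w y ∂μ = ∫ y, v y * w (F y) ∂μ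

/-- The inclusion `L^∞ ⊆ L¹` on a finite measure space. -/
def linftyToL1 (μ : Measure Y) [IsFiniteMeasure μ] (v : Lp ℂ ∞ μ) : Lp ℂ 1 μ :=
  ((Lp.memLp v).mono_exponent (p := 1) le_top).toLp v

/-- The product `1_{φ = n} · v` in `L¹`. -/
def cutoff (μ : Measure Y) {φ : Y → ℕ} (hφ : Measurable φ) (n : ℕ) (v : Lp ℂ 1 μ) : Lp ℂ 1 μ :=
  ((Lp.memLp v).indicator (hφ (measurableSet_singleton n))).toLp
    (Set.indicator (φ ⁻¹' {n}) v)

end Transfer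

section Spectral

variable {B : Type*} [NormedAddCommGroup B] [NormedSpace ℂ B]

/-- The operator `(2πi)⁻¹ ∮_{|ζ - c| = r} (ζ - A)⁻¹ dζ`. If the circle lies in the resolvent set of
`A`, this is the spectral projection of `A` for the part of the spectrum inside the circle. -/
def rieszProjection (A : B →L[ℂ] B) (c : ℂ) (r : ℝ) : B →L[ℂ] B :=
  (2 * Real.pi * Complex.I : ℂ)⁻¹ • ∮ ζ in C(c, r), resolvent A ζ

/-- `c` is a simple isolated eigenvalue of `A`: it is an eigenvalue, it is an isolated point of the
spectrum, and its algebraic multiplicity, the rank of the spectral projection, is one.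
(The spectral projection does not depend on the choice of `r`.) -/
def IsSimpleIsolatedEigenvalue (A : B →L[ℂ] B) (c : ℂ) : Prop :=
  Module.End.HasEigenvalue (A : B →ₗ[ℂ] B) c ∧
  ∃ r : ℝ, 0 < r ∧ spectrum ℂ A ∩ Metric.closedBall c r = {c} ∧
    Module.finrank ℂ (LinearMap.range (rieszProjection A c r : B →ₗ[ℂ] B)) = 1

end Spectral

section Renewal

variable {B : Type*} [NormedAddCommGroup B] [NormedSpace ℂ B]

/-- `R(z) = ∑_{n ≥ 1} zⁿ R_n`. (The value `Rn 0` is never used.) -/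
def renewalSeries (Rn : ℕ → B →L[ℂ] B) (z : ℂ) : B →L[ℂ] B :=
  ∑' n : ℕ, z ^ (n + 1) • Rn (n + 1)

/-- The renewal operators: `T_0 = I` and `T_n = ∑_{j=1}^n T_{n-j} R_j` for `n ≥ 1`. -/
def renewalOp (Rn : ℕ → B →L[ℂ] B) : ℕ → B →L[ℂ] B
  | 0 => ContinuousLinearMap.id ℂ B
  | n + 1 => ∑ j : Fin (n + 1), (renewalOp Rn (n - j)).comp (Rn (j + 1))

theorem renewalOp_zero (Rn : ℕ → B →L[ℂ] B) :
    renewalOp Rn 0 = ContinuousLinearMap.id ℂ B := by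
  rw [renewalOp]

theorem renewalOp_eq_sum (Rn : ℕ → B →L[ℂ] B) (n : ℕ) (hn : 1 ≤ n) :
    renewalOp Rn n = ∑ j ∈ Finset.Icc 1 n, (renewalOp Rn (n - j)).comp (Rn j) := by
  obtain ⟨m, rfl⟩ : ∃ m, n = m + 1 := ⟨n - 1, by omega⟩
  rw [renewalOp, Fin.sum_univ_eq_sum_range
    (fun j => (renewalOp Rn (m - j)).comp (Rn (j + 1))) (m + 1),
    Finset.range_eq_Ico, ← Finset.Ico_add_one_right_eq_Icc,
    Finset.sum_Ico_eq_sum_range, Finset.sum_Ico_eq_sum_range]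
  refine Finset.sum_congr (by simp) fun j _ => ?_
  rw [show m + 1 - (1 + j) = m - (0 + j) by omega, show 0 + j + 1 = 1 + j by omega]

end Renewal

end

/-- If `a (2 k) / a k → 2 ^ (-β)` for a positive antitone sequence `a` and `β < p`, then
`n ^ p * a n` is almost increasing. -/
theorem exists_rpow_mul_le_of_tendsto_ratio {a : ℕ → ℝ} (ha : Antitone a) (hpos : ∀ n, 0 < a n)
    {β p : ℝ} (hp : 0 < p) (hβp : β < p)
    (hlim : Tendsto (fun n => a (2 * n) / a n) atTop (𝓝 ((2 : ℝ) ^ (-β)))) :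
    ∃ C : ℝ, 0 < C ∧ ∀ j n : ℕ, 1 ≤ j → j ≤ n → (j : ℝ) ^ p * a j ≤ C * ((n : ℝ) ^ p * a n) := by
  have h2 : (2 : ℝ) ^ (-p) < 2 ^ (-β) :=
    Real.rpow_lt_rpow_of_exponent_lt one_lt_two (by linarith)
  obtain ⟨N₁, hN₁⟩ := eventually_atTop.1 (hlim.eventually (lt_mem_nhds h2))
  set N := max N₁ 1 with hN
  have hdouble : ∀ k, N ≤ k → a k ≤ 2 ^ p * a (2 * k) := by
    intro k hk
    have := hN₁ k (le_trans (le_max_left _ _) hk)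
    rw [lt_div_iff₀ (hpos k), Real.rpow_neg (by norm_num)] at this
    have h3 : (0 : ℝ) < 2 ^ p := by positivity
    have := mul_le_mul_of_nonneg_left this.le h3.le
    rwa [← mul_assoc, mul_inv_cancel₀ h3.ne', one_mul] at this
  have hlarge : ∀ d j n : ℕ, n - j ≤ d → N ≤ j → j ≤ n →
      (j : ℝ) ^ p * a j ≤ 2 ^ p * ((n : ℝ) ^ p * a n) := by
    intro d
    induction d with
    | zero =>
      intro j n h1 _ h3
      obtain rfl : j = n := by omega
      have : (1 : ℝ) ≤ 2 ^ p := Real.one_le_rpow one_le_two hp.le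
      have h0 : 0 ≤ (j : ℝ) ^ p * a j := mul_nonneg (by positivity) (hpos j).le
      nlinarith
    | succ d ih =>
      intro j n h1 h2 h3
      have hj : 1 ≤ j := le_trans (le_max_right _ _) h2
      by_cases h : n < 2 * j
      · calc (j : ℝ) ^ p * a j ≤ (n : ℝ) ^ p * (2 ^ p * a n) := by
              gcongr
              · exact (hpos j).le
              · refine (hdouble j h2).trans ?_
                gcongr
                exact ha h.le
          _ = _ := by ring
      · refine le_trans ?_ (ih (2 * j) n (by omega) (by omega) (by omega))
        push_cast
        rw [Real.mul_rpow (by norm_num) (by positivity), mul_comm ((2 : ℝ) ^ p), mul_assoc]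
        gcongr
        exact hdouble j h2
  have hN1 : (1 : ℝ) ≤ N := by exact_mod_cast le_max_right N₁ 1
  have hNp : (1 : ℝ) ≤ (N : ℝ) ^ p := Real.one_le_rpow hN1 hp.le
  have hup : ∀ j : ℕ, 1 ≤ j →
      (j : ℝ) ^ p * a j ≤ a 1 / a N * ((max j N : ℕ) ^ p * a (max j N)) := by
    intro j hj
    rcases le_total N j with h | h
    · rw [max_eq_left h]
      have : 1 ≤ a 1 / a N := by
        rw [le_div_iff₀ (hpos N), one_mul]; exact ha (le_max_right _ _)
      have h0 : 0 ≤ (j : ℝ) ^ p * a j := mul_nonneg (by positivity) (hpos j).le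
      nlinarith
    · rw [max_eq_right h]
      calc (j : ℝ) ^ p * a j ≤ (N : ℝ) ^ p * a 1 := by
            gcongr
            · exact (hpos j).le
            · exact ha hj
        _ = _ := by field_simp [(hpos N).ne']
  have hdown : ∀ n : ℕ, 1 ≤ n →
      ((max n N : ℕ) : ℝ) ^ p * a (max n N) ≤ (N : ℝ) ^ p * ((n : ℝ) ^ p * a n) := by
    intro n hn
    have hn1 : (1 : ℝ) ≤ (n : ℝ) ^ p := Real.one_le_rpow (by exact_mod_cast hn) hp.le
    have h0 : 0 ≤ (n : ℝ) ^ p * a n := mul_nonneg (by positivity) (hpos n).le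
    rcases le_total N n with h | h
    · rw [max_eq_left h]
      nlinarith
    · rw [max_eq_right h]
      gcongr
      exact (ha h).trans (le_mul_of_one_le_left (hpos n).le hn1)
  refine ⟨a 1 / a N * (2 ^ p * (N : ℝ) ^ p), ?_, fun j n hj hjn => ?_⟩
  · have := hpos 1; have := hpos N; positivity
  · have h1 := hup j hj
    have h2 := hlarge _ (max j N) (max n N) le_rfl (le_max_right _ _) (max_le_max_right N hjn)
    have h3 := hdown n (hj.trans hjn)
    calc _ ≤ _ := h1
      _ ≤ a 1 / a N * (2 ^ p * ((N : ℝ) ^ p * ((n : ℝ) ^ p * a n))) := by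
        have := hpos 1; have := hpos N
        refine mul_le_mul_of_nonneg_left (h2.trans ?_) (by positivity)
        gcongr
      _ = _ := by ring

theorem sum_inv_sqrt_le (n : ℕ) : ∑ j ∈ Finset.range n, 1 / √((j : ℝ) + 1) ≤ 2 * √n := by
  induction n with
  | zero => simp
  | succ n ih =>
    rw [Finset.sum_range_succ]
    have h1 : 0 < √((n : ℝ) + 1) := Real.sqrt_pos.2 (by positivity)
    have h2 : 1 / √((n : ℝ) + 1) ≤ 2 * (√((n : ℝ) + 1) - √n) := by
      rw [div_le_iff₀ h1]
      have e1 := Real.sq_sqrt (show (0 : ℝ) ≤ n + 1 by positivity)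
      have e2 := Real.sq_sqrt (show (0 : ℝ) ≤ n by positivity)
      nlinarith [sq_nonneg (√((n : ℝ) + 1) - √n)]
    push_cast
    linarith

/-- The direct half of Karamata's theorem, for exponents below `1 / 2`. -/
theorem exists_sum_range_le_mul {a : ℕ → ℝ} (hpos : ∀ n, 0 < a n)
    {p C : ℝ} (hp' : p ≤ 1 / 2) (hC : 0 < C)
    (h : ∀ j n : ℕ, 1 ≤ j → j ≤ n → (j : ℝ) ^ p * a j ≤ C * ((n : ℝ) ^ p * a n)) :
    ∃ D : ℝ, 0 < D ∧ ∀ n : ℕ, 1 ≤ n → ∑ j ∈ Finset.range n, a j ≤ D * (n * a n) := by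
  have key : ∀ j n : ℕ, 1 ≤ j → j ≤ n → a j ≤ C * a n * (√n * (1 / √j)) := by
    intro j n hj hjn
    have hj0 : (0 : ℝ) < j := by exact_mod_cast hj
    have hn0 : (0 : ℝ) < n := by exact_mod_cast hj.trans hjn
    have h1 : a j ≤ C * a n * ((n : ℝ) / j) ^ p := by
      rw [Real.div_rpow hn0.le hj0.le, ← mul_div_assoc, le_div_iff₀ (by positivity)]
      linarith [h j n hj hjn]
    have h2 : ((n : ℝ) / j) ^ p ≤ √n * (1 / √j) := by
      rw [mul_one_div, ← Real.sqrt_div hn0.le, Real.sqrt_eq_rpow]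
      exact Real.rpow_le_rpow_of_exponent_le
        ((one_le_div hj0).2 (by exact_mod_cast hjn)) hp'
    exact h1.trans (mul_le_mul_of_nonneg_left h2 (mul_pos hC (hpos n)).le)
  refine ⟨a 0 / a 1 * C + 2 * C, ?_, fun n hn => ?_⟩
  · have := hpos 0; have := hpos 1; positivity
  have hn1 : (1 : ℝ) ≤ n := by exact_mod_cast hn
  have hsq : √(n : ℝ) * √n = n := Real.mul_self_sqrt (by positivity)
  have hs1 : √(n : ℝ) ≤ n := by
    rw [Real.sqrt_le_left (by positivity)]; nlinarith
  obtain ⟨m, rfl⟩ : ∃ m, n = m + 1 := ⟨n - 1, by omega⟩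
  rw [Finset.sum_range_succ']
  have ha0 : a 0 ≤ a 0 / a 1 * C * ((m + 1 : ℕ) * a (m + 1)) := by
    have h1 := key 1 (m + 1) le_rfl hn
    simp only [Nat.cast_one, Real.sqrt_one, div_one, mul_one] at h1
    have h2 : a 1 ≤ C * ((m + 1 : ℕ) * a (m + 1)) := by
      refine h1.trans ?_
      rw [mul_assoc, mul_comm (a _)]
      have := hpos (m + 1)
      gcongr
    calc a 0 = a 0 / a 1 * a 1 := by field_simp [(hpos 1).ne']
      _ ≤ a 0 / a 1 * (C * ((m + 1 : ℕ) * a (m + 1))) := by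
        have := hpos 0; have := hpos 1
        gcongr
      _ = _ := by ring
  have hrest : ∑ j ∈ Finset.range m, a (j + 1) ≤ 2 * C * ((m + 1 : ℕ) * a (m + 1)) := by
    have hCa := mul_pos hC (hpos (m + 1))
    calc ∑ j ∈ Finset.range m, a (j + 1)
        ≤ ∑ j ∈ Finset.range m, C * a (m + 1) * (√(m + 1 : ℕ) * (1 / √((j : ℝ) + 1))) := by
          refine Finset.sum_le_sum fun j hj => ?_
          have := key (j + 1) (m + 1) (by omega) (by simp at hj; omega)
          push_cast at this ⊢
          exact this
      _ = C * a (m + 1) * (√(m + 1 : ℕ) * ∑ j ∈ Finset.range m, (1 / √((j : ℝ) + 1))) := by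
          simp only [Finset.mul_sum]
      _ ≤ C * a (m + 1) * (√(m + 1 : ℕ) * (2 * √(m + 1 : ℕ))) := by
          gcongr
          refine (sum_inv_sqrt_le m).trans ?_
          gcongr
          omega
      _ = 2 * C * a (m + 1) * (√(m + 1 : ℕ) * √(m + 1 : ℕ)) := by ring
      _ = _ := by rw [hsq]; ring
  linarith

/-- Summation by parts for the weights `a k - a (k + 1)` against `min 2 ((k + 1) h)`. -/
theorem sum_min_mul_sub_le {a : ℕ → ℝ} (ha : Antitone a) (hpos : ∀ n, 0 < a n) {h : ℝ}
    (hh : 0 ≤ h) (n M : ℕ) :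
    ∑ k ∈ Finset.range M, min 2 ((k + 1) * h) * (a k - a (k + 1))
      ≤ h * ∑ k ∈ Finset.range n, a k + 2 * a n := by
  set g : ℕ → ℝ := fun k => min 2 (k * h) with hg
  have hg0 : g 0 = 0 := by simp [hg]
  have hstep : ∀ k, g k ≤ g (k + 1) := fun k => by
    simp only [hg]; push_cast; exact min_le_min_left _ (by nlinarith)
  have hstep' : ∀ k, g (k + 1) - g k ≤ h := fun k => by
    simp only [hg]; push_cast
    rcases le_total 2 ((k : ℝ) * h) with h1 | h1
    · rw [min_eq_left h1]; linarith [min_le_left 2 (((k : ℝ) + 1) * h)]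
    · rw [min_eq_right h1]; linarith [min_le_right 2 (((k : ℝ) + 1) * h)]
  have hgn : ∀ k, 0 ≤ g k := fun k => le_min (by norm_num) (by positivity)
  have habel : ∑ k ∈ Finset.range M, min 2 ((k + 1) * h) * (a k - a (k + 1)) + g M * a M
      = ∑ k ∈ Finset.range M, (g (k + 1) - g k) * a k := by
    induction M with
    | zero => simp [hg0]
    | succ M ih =>
      rw [Finset.sum_range_succ, Finset.sum_range_succ, ← ih]
      have : min 2 (((M : ℝ) + 1) * h) = g (M + 1) := by simp [hg]
      rw [this]; ring
  have hterm : ∀ k, (g (k + 1) - g k) * a k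
      ≤ (if k < n then h * a k else 0) + (g (k + 1) - g k) * a n := by
    intro k
    have h1 := sub_nonneg.2 (hstep k)
    split_ifs with hk
    · have := mul_le_mul_of_nonneg_right (hstep' k) (hpos k).le
      have := mul_nonneg h1 (hpos n).le
      linarith
    · rw [zero_add]
      exact mul_le_mul_of_nonneg_left (ha (by omega)) h1
  have hsum1 : ∑ k ∈ Finset.range M, (if k < n then h * a k else 0)
      ≤ h * ∑ k ∈ Finset.range n, a k := by
    rw [← Finset.sum_filter, Finset.mul_sum]
    refine Finset.sum_le_sum_of_subset_of_nonneg (fun k => by simp) fun k _ _ => ?_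
    exact mul_nonneg hh (hpos k).le
  have hsum2 : ∑ k ∈ Finset.range M, (g (k + 1) - g k) * a n ≤ 2 * a n := by
    rw [← Finset.sum_mul, Finset.sum_range_sub, hg0, sub_zero]
    exact mul_le_mul_of_nonneg_right (min_le_left _ _) (hpos n).le
  have := Finset.sum_le_sum fun k (_ : k ∈ Finset.range M) => hterm k
  rw [Finset.sum_add_distrib] at this
  have := mul_nonneg (hgn M) (hpos M).le
  linarith

theorem summable_sub_succ_of_antitone {a : ℕ → ℝ} (ha : Antitone a) (hpos : ∀ n, 0 < a n) :
    Summable fun k => a k - a (k + 1) := by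
  refine summable_of_sum_range_le (c := a 0) (fun k => sub_nonneg.2 (ha k.le_succ)) fun n => ?_
  rw [Finset.sum_range_sub']
  linarith [hpos n]

theorem summable_mul_sub_succ_of_antitone {a : ℕ → ℝ} (ha : Antitone a) (hpos : ∀ n, 0 < a n)
    {g : ℕ → ℝ} {K : ℝ} (hg : ∀ k, |g k| ≤ K) :
    Summable fun k => g k * (a k - a (k + 1)) := by
  refine Summable.of_norm_bounded ((summable_sub_succ_of_antitone ha hpos).mul_left K) fun k => ?_
  rw [norm_mul, Real.norm_eq_abs, Real.norm_eq_abs, abs_of_nonneg (sub_nonneg.2 (ha k.le_succ))]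
  exact mul_le_mul_of_nonneg_right (hg k) (sub_nonneg.2 (ha k.le_succ))

theorem abs_min_two_le {x : ℝ} (hx : 0 ≤ x) : |min 2 x| ≤ 2 := by
  rw [abs_of_nonneg (le_min (by norm_num) hx)]; exact min_le_left _ _

theorem abs_one_sub_cos_le (x : ℝ) : |1 - Real.cos x| ≤ 2 := by
  rw [abs_le]; constructor <;> linarith [Real.cos_le_one x, Real.neg_one_le_cos x]

/-- The truncated first moment of a regularly varying tail. -/
theorem tsum_min_mul_sub_le {a : ℕ → ℝ} (ha : Antitone a) (hpos : ∀ n, 0 < a n) {D : ℝ}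
    (hD : 0 < D) (h : ∀ n : ℕ, 1 ≤ n → ∑ j ∈ Finset.range n, a j ≤ D * (n * a n)) :
    ∀ (n : ℕ) (s : ℝ), 1 ≤ n → 0 ≤ s → s * n ≤ 4 →
      ∑' k : ℕ, min 2 ((k + 1) * s) * (a k - a (k + 1)) ≤ (4 * D + 2) * a n := by
  intro n s hn hs hsn
  refine Real.tsum_le_of_sum_range_le (fun k => ?_) fun M => ?_
  · exact mul_nonneg (le_min (by norm_num) (by positivity)) (sub_nonneg.2 (ha k.le_succ))
  refine (sum_min_mul_sub_le ha hpos hs n M).trans ?_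
  have h1 := mul_le_mul_of_nonneg_left (h n hn) hs
  have h2 := mul_le_mul_of_nonneg_right hsn (mul_pos hD (hpos n)).le
  linarith

/-- Lower bounds for `∑ (1 - cos ((k + 1) θ)) (a k - a (k + 1))` for a regularly varying tail. -/
theorem exists_le_tsum_one_sub_cos {a : ℕ → ℝ} (ha : Antitone a) (hpos : ∀ n, 0 < a n)
    {β p : ℝ} (hβ : 0 < β) (hβp : β < p) (hp : p ≤ 1 / 2)
    (hlim : Tendsto (fun n => a (2 * n) / a n) atTop (𝓝 ((2 : ℝ) ^ (-β)))) :
    ∃ K : ℝ, 0 < K ∧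
      (∀ (n : ℕ) (s : ℝ), 1 ≤ n → 0 ≤ s → s * n ≤ 4 →
        ∑' k : ℕ, min 2 ((k + 1) * s) * (a k - a (k + 1)) ≤ K * a n) ∧
      ∃ θ₀ : ℝ, 0 < θ₀ ∧ ∀ θ : ℝ, 0 < θ → θ ≤ θ₀ →
        ∑' k : ℕ, min 2 ((k + 1) * θ) * (a k - a (k + 1)) ≤
          K * ∑' k : ℕ, (1 - Real.cos ((k + 1) * θ)) * (a k - a (k + 1)) ∧
        θ ^ p ≤ K * ∑' k : ℕ, (1 - Real.cos ((k + 1) * θ)) * (a k - a (k + 1)) := by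
  have hp0 : 0 < p := hβ.trans hβp
  obtain ⟨C, hC, hCle⟩ := exists_rpow_mul_le_of_tendsto_ratio ha hpos hp0 hβp hlim
  obtain ⟨D, hD, hDle⟩ := exists_sum_range_le_mul hpos hp hC hCle
  have hG := tsum_min_mul_sub_le ha hpos hD hDle
  set E := 4 * D + 2 with hE
  have hE0 : 0 < E := by positivity
  have h2β : (2 : ℝ) ^ (-β) < 1 := Real.rpow_lt_one_of_one_lt_of_neg one_lt_two (by linarith)
  obtain ⟨q, hq1, hq2⟩ := exists_between h2β
  obtain ⟨N₁, hN₁⟩ := eventually_atTop.1 (hlim.eventually (gt_mem_nhds hq1))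
  have hcos : 0 < 1 - Real.cos 1 := by
    have := Real.cos_one_le; linarith
  set c := (1 - Real.cos 1) * (1 - q) with hc
  have hc0 : 0 < c := mul_pos hcos (by linarith)
  have ha1 := hpos 1
  have hlow : ∀ (N : ℕ) (θ : ℝ), N₁ ≤ N → 0 < θ → 1 < (N + 1) * θ → N * θ ≤ 1 →
      c * a N ≤ ∑' k : ℕ, (1 - Real.cos ((k + 1) * θ)) * (a k - a (k + 1)) := by
    intro N θ hN hθ h1 h2
    have hs := summable_mul_sub_succ_of_antitone ha hpos
      (g := fun k : ℕ => 1 - Real.cos ((k + 1) * θ)) fun k => abs_one_sub_cos_le _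
    refine le_trans ?_ (hs.sum_le_tsum (Finset.Ico N (2 * N)) fun k _ =>
      mul_nonneg (by linarith [Real.cos_le_one ((k + 1) * θ)]) (sub_nonneg.2 (ha k.le_succ)))
    have h3 : a N - a (2 * N) = ∑ k ∈ Finset.Ico N (2 * N), (a k - a (k + 1)) := by
      rw [Finset.sum_Ico_eq_sub _ (by omega), Finset.sum_range_sub', Finset.sum_range_sub']
      ring
    have h4 : (1 - q) * a N ≤ a N - a (2 * N) := by
      have := hN₁ N hN
      rw [div_lt_iff₀ (hpos N)] at this
      linarith
    calc c * a N = (1 - Real.cos 1) * ((1 - q) * a N) := by rw [hc]; ring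
      _ ≤ (1 - Real.cos 1) * (a N - a (2 * N)) := mul_le_mul_of_nonneg_left h4 hcos.le
      _ = ∑ k ∈ Finset.Ico N (2 * N), (1 - Real.cos 1) * (a k - a (k + 1)) := by
          rw [h3, Finset.mul_sum]
      _ ≤ _ := by
          refine Finset.sum_le_sum fun k hk => ?_
          refine mul_le_mul_of_nonneg_right ?_ (sub_nonneg.2 (ha k.le_succ))
          rw [Finset.mem_Ico] at hk
          have hk1 : (N : ℝ) ≤ k := by exact_mod_cast hk.1
          have hk2 : (k : ℝ) + 1 ≤ 2 * N := by exact_mod_cast hk.2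
          have : Real.cos ((k + 1) * θ) ≤ Real.cos 1 := by
            refine Real.cos_le_cos_of_nonneg_of_le_pi (by norm_num) ?_ (by nlinarith)
            nlinarith [Real.pi_gt_three]
          linarith
  refine ⟨E + E / c + C / (c * a 1), by positivity, fun n s hn hs hsn => ?_,
    1 / (N₁ + 1), by positivity, fun θ hθ hθ' => ?_⟩
  · refine (hG n s hn hs hsn).trans (mul_le_mul_of_nonneg_right ?_ (hpos n).le)
    have : 0 < E / c + C / (c * a 1) := by positivity
    linarith
  have hN1 : ((N₁ : ℝ) + 1) ≤ 1 / θ := by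
    rw [le_div_iff₀ hθ]; rwa [le_div_iff₀ (by positivity), mul_comm] at hθ'
  set N := ⌊1 / θ⌋₊ with hN
  have hNN : N₁ + 1 ≤ N := Nat.le_floor (by exact_mod_cast hN1)
  have h1 : 1 < ((N : ℝ) + 1) * θ := by
    rw [← div_lt_iff₀ hθ]; exact Nat.lt_floor_add_one _
  have h2 : (N : ℝ) * θ ≤ 1 := by
    rw [← le_div_iff₀ hθ]; exact Nat.floor_le (by positivity)
  have hl := hlow N θ (by omega) hθ h1 h2
  set S := ∑' k : ℕ, (1 - Real.cos ((k + 1) * θ)) * (a k - a (k + 1)) with hS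
  have hS' : a N ≤ S / c := by rw [le_div_iff₀ hc0]; linarith
  have hS0 : 0 ≤ S := (mul_pos hc0 (hpos N)).le.trans hl
  constructor
  · refine (hG N θ (by omega) hθ.le (by linarith)).trans ?_
    have e1 : E * a N ≤ E / c * S := by
      calc E * a N ≤ E * (S / c) := mul_le_mul_of_nonneg_left hS' hE0.le
        _ = _ := by ring
    have e2 : 0 ≤ (E + C / (c * a 1)) * S := by positivity
    linarith
  · have hNpos : (0 : ℝ) < N := by exact_mod_cast (by omega : 0 < N)
    have e0 := hCle 1 N le_rfl (by omega)
    simp only [Nat.cast_one, Real.one_rpow, one_mul] at e0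
    have e1 : θ ^ p * (N : ℝ) ^ p ≤ 1 := by
      rw [← Real.mul_rpow hθ.le hNpos.le]
      exact Real.rpow_le_one (by positivity) (by linarith) hp0.le
    have e2 : θ ^ p * a 1 ≤ C * a N := by
      calc θ ^ p * a 1 ≤ θ ^ p * (C * ((N : ℝ) ^ p * a N)) := by gcongr
        _ = (θ ^ p * (N : ℝ) ^ p) * (C * a N) := by ring
        _ ≤ 1 * (C * a N) := mul_le_mul_of_nonneg_right e1 (mul_pos hC (hpos N)).le
        _ = _ := one_mul _
    have e3 : θ ^ p ≤ C / (c * a 1) * S := by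
      rw [div_mul_eq_mul_div, le_div_iff₀ (by positivity)]
      calc θ ^ p * (c * a 1) = c * (θ ^ p * a 1) := by ring
        _ ≤ c * (C * a N) := by gcongr
        _ = C * (c * a N) := by ring
        _ ≤ C * S := by gcongr
    have e4 : 0 ≤ (E + E / c) * S := by positivity
    linarith

section RenewalSeries

variable {B : Type*} [NormedAddCommGroup B] [NormedSpace ℂ B]

theorem renewalOp_succ_eq_sum_antidiagonal (Rn : ℕ → B →L[ℂ] B) (n : ℕ) :
    renewalOp Rn (n + 1) =
      ∑ kl ∈ Finset.HasAntidiagonal.antidiagonal n, renewalOp Rn kl.1 * Rn (kl.2 + 1) := by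
  rw [← Finset.Nat.sum_antidiagonal_swap, Finset.Nat.sum_antidiagonal_eq_sum_range_succ_mk,
    renewalOp, ← Fin.sum_univ_eq_sum_range
      (fun j => renewalOp Rn (Prod.swap (j, n - j)).1 * Rn ((Prod.swap (j, n - j)).2 + 1))]
  rfl

theorem norm_renewalOp_le_pow {Rn : ℕ → B →L[ℂ] B} (hsum : Summable fun n => ‖Rn (n + 1)‖)
    (n : ℕ) : ‖renewalOp Rn n‖ ≤ (1 + ∑' n, ‖Rn (n + 1)‖) ^ n := by
  set S := ∑' n, ‖Rn (n + 1)‖ with hS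
  have hS0 : 0 ≤ S := tsum_nonneg fun n => norm_nonneg _
  induction n using Nat.strong_induction_on with
  | _ n ih =>
    rcases n with _ | n
    · simpa [renewalOp_zero] using ContinuousLinearMap.norm_id_le
    rw [renewalOp, Fin.sum_univ_eq_sum_range
      (fun j => (renewalOp Rn (n - j)).comp (Rn (j + 1))) (n + 1)]
    calc ‖∑ j ∈ Finset.range (n + 1), (renewalOp Rn (n - j)).comp (Rn (j + 1))‖
        ≤ ∑ j ∈ Finset.range (n + 1), (1 + S) ^ n * ‖Rn (j + 1)‖ := by
          refine norm_sum_le_of_le _ fun j _ => (ContinuousLinearMap.opNorm_comp_le _ _).trans ?_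
          refine mul_le_mul_of_nonneg_right ((ih (n - j) (by omega)).trans ?_) (norm_nonneg _)
          exact pow_le_pow_right₀ (by linarith) (by omega)
      _ = (1 + S) ^ n * ∑ j ∈ Finset.range (n + 1), ‖Rn (j + 1)‖ := by rw [Finset.mul_sum]
      _ ≤ (1 + S) ^ n * (1 + S) := by
          gcongr
          linarith [hsum.sum_le_tsum (Finset.range (n + 1)) fun j _ => norm_nonneg _]
      _ = (1 + S) ^ (n + 1) := (pow_succ _ _).symm

theorem norm_pow_smul_le {E : Type*} [NormedAddCommGroup E] [NormedSpace ℂ E] {z : ℂ}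
    (hz : ‖z‖ ≤ 1) (n : ℕ) (x : E) : ‖z ^ n • x‖ ≤ ‖x‖ := by
  rw [norm_smul, norm_pow]
  exact mul_le_of_le_one_left (norm_nonneg _) (pow_le_one₀ (norm_nonneg _) hz)

theorem summable_norm_renewalSeries {Rn : ℕ → B →L[ℂ] B}
    (hsum : Summable fun n => ‖Rn (n + 1)‖) {z : ℂ} (hz : ‖z‖ ≤ 1) :
    Summable fun n => ‖z ^ (n + 1) • Rn (n + 1)‖ :=
  hsum.of_nonneg_of_le (fun _ => norm_nonneg _) fun n => norm_pow_smul_le hz (n + 1) (Rn (n + 1))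

variable [CompleteSpace B]

theorem hasSum_renewalSeries {Rn : ℕ → B →L[ℂ] B}
    (hsum : Summable fun n => ‖Rn (n + 1)‖) {z : ℂ} (hz : ‖z‖ ≤ 1) :
    HasSum (fun n => z ^ (n + 1) • Rn (n + 1)) (renewalSeries Rn z) :=
  (summable_norm_renewalSeries hsum hz).of_norm.hasSum

theorem continuousOn_renewalSeries {Rn : ℕ → B →L[ℂ] B}
    (hsum : Summable fun n => ‖Rn (n + 1)‖) :
    ContinuousOn (renewalSeries Rn) (Metric.closedBall 0 1) := by
  refine continuousOn_tsum (fun n => by fun_prop) hsum fun n z hz => ?_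
  exact norm_pow_smul_le (by simpa using hz) (n + 1) (Rn (n + 1))

theorem differentiableOn_renewalSeries {Rn : ℕ → B →L[ℂ] B}
    (hsum : Summable fun n => ‖Rn (n + 1)‖) :
    DifferentiableOn ℂ (renewalSeries Rn) (Metric.ball 0 1) := by
  refine Complex.differentiableOn_tsum_of_summable_norm hsum (fun n => by fun_prop)
    Metric.isOpen_ball fun n z hz => ?_
  exact norm_pow_smul_le (by simpa using (Metric.mem_ball.1 hz).le) (n + 1) (Rn (n + 1))

/-- Near the origin, the generating function of the renewal operators is `(1 - R(z))⁻¹`. -/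
theorem hasSum_renewalOp {Rn : ℕ → B →L[ℂ] B} (hsum : Summable fun n => ‖Rn (n + 1)‖) {z : ℂ}
    (hz : ‖z‖ * (1 + ∑' n, ‖Rn (n + 1)‖) < 1) (hunit : IsUnit (1 - renewalSeries Rn z)) :
    HasSum (fun n => z ^ n • renewalOp Rn n) (Ring.inverse (1 - renewalSeries Rn z)) := by
  set S := ∑' n, ‖Rn (n + 1)‖ with hS
  have hS0 : 0 ≤ S := tsum_nonneg fun n => norm_nonneg _
  have hz1 : ‖z‖ ≤ 1 := by nlinarith [norm_nonneg z]
  have hf : Summable fun n => ‖z ^ n • renewalOp Rn n‖ := by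
    refine (summable_geometric_of_lt_one (by positivity) hz).of_nonneg_of_le
      (fun _ => norm_nonneg _) fun n => ?_
    rw [norm_smul, norm_pow, mul_pow]
    gcongr
    exact norm_renewalOp_le_pow hsum n
  have hg := summable_norm_renewalSeries hsum hz1
  have hprod := tsum_mul_tsum_eq_tsum_sum_antidiagonal_of_summable_norm hf hg
  have hterm : ∀ n, ∑ kl ∈ Finset.HasAntidiagonal.antidiagonal n,
      (z ^ kl.1 • renewalOp Rn kl.1) * (z ^ (kl.2 + 1) • Rn (kl.2 + 1))
      = z ^ (n + 1) • renewalOp Rn (n + 1) := by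
    intro n
    rw [renewalOp_succ_eq_sum_antidiagonal, Finset.smul_sum]
    refine Finset.sum_congr rfl fun kl hkl => ?_
    rw [Finset.HasAntidiagonal.mem_antidiagonal] at hkl
    rw [smul_mul_smul_comm, ← pow_add, ← add_assoc, hkl]
  simp only [hterm] at hprod
  have hzero := hf.of_norm.tsum_eq_zero_add
  simp only [pow_zero, one_smul, renewalOp_zero] at hzero
  rw [← hprod] at hzero
  set X := ∑' n, z ^ n • renewalOp Rn n with hX
  have hX1 : X * (1 - renewalSeries Rn z) = 1 := by
    rw [mul_sub, mul_one, sub_eq_iff_eq_add]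
    exact hzero
  have : Ring.inverse (1 - renewalSeries Rn z) = X := by
    have := congrArg (· * Ring.inverse (1 - renewalSeries Rn z)) hX1
    simpa only [mul_assoc, Ring.mul_inverse_cancel _ hunit, mul_one, one_mul] using this.symm
  rw [this]
  exact hf.of_norm.hasSum

theorem differentiableAt_inverse_one_sub_renewalSeries {Rn : ℕ → B →L[ℂ] B}
    (hsum : Summable fun n => ‖Rn (n + 1)‖)
    (hunit : ∀ z : ℂ, ‖z‖ < 1 → IsUnit (1 - renewalSeries Rn z)) {z : ℂ} (hz : ‖z‖ < 1) :
    DifferentiableAt ℂ (fun z => Ring.inverse (1 - renewalSeries Rn z)) z := by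
  have h1 : DifferentiableAt ℂ (renewalSeries Rn) z :=
    (differentiableOn_renewalSeries hsum).differentiableAt
      (Metric.isOpen_ball.mem_nhds (by simpa using hz))
  have h2 : DifferentiableAt ℂ (fun z => 1 - renewalSeries Rn z) z :=
    (differentiableAt_const _).sub h1
  exact (differentiableAt_inverse (hunit z hz)).comp z h2

theorem renewalOp_eq_circleIntegral {Rn : ℕ → B →L[ℂ] B}
    (hsum : Summable fun n => ‖Rn (n + 1)‖)
    (hunit : ∀ z : ℂ, ‖z‖ < 1 → IsUnit (1 - renewalSeries Rn z)) {ρ : ℝ} (hρ : 0 < ρ)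
    (hρ1 : ρ < 1) (n : ℕ) :
    renewalOp Rn n = (2 * Real.pi * Complex.I : ℂ)⁻¹ • ∮ z in C(0, ρ),
      (1 / (z - 0)) ^ n • (z - 0)⁻¹ • Ring.inverse (1 - renewalSeries Rn z) := by
  set f : ℂ → B →L[ℂ] B := fun z => Ring.inverse (1 - renewalSeries Rn z) with hf
  lift ρ to NNReal using hρ.le
  have hdiff : DifferentiableOn ℂ f (Metric.closedBall 0 ρ) := fun z hz =>
    (differentiableAt_inverse_one_sub_renewalSeries hsum hunit
      (lt_of_le_of_lt (by simpa using hz) hρ1)).differentiableWithinAt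
  have h1 := (hdiff.hasFPowerSeriesOnBall (by exact_mod_cast hρ)).hasFPowerSeriesAt
  set q : FormalMultilinearSeries ℂ ℂ (B →L[ℂ] B) := fun n =>
    ContinuousMultilinearMap.mkPiRing ℂ (Fin n) (renewalOp Rn n) with hq
  have hcoeff : ∀ n, q.coeff n = renewalOp Rn n := fun n => by
    simp [FormalMultilinearSeries.coeff, hq]
  have h2 : HasFPowerSeriesAt f q 0 := by
    rw [hasFPowerSeriesAt_iff]
    set S := ∑' n, ‖Rn (n + 1)‖ with hS
    have hS0 : 0 ≤ S := tsum_nonneg fun n => norm_nonneg _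
    have hcont : Tendsto (fun z : ℂ => ‖z‖ * (1 + S)) (𝓝 0) (𝓝 0) := by
      have : Continuous fun z : ℂ => ‖z‖ * (1 + S) := by fun_prop
      simpa using this.tendsto 0
    filter_upwards [hcont.eventually (gt_mem_nhds one_pos)] with z hz
    have hz1 : ‖z‖ < 1 := by nlinarith [norm_nonneg z]
    simp only [hcoeff, zero_add]
    exact hasSum_renewalOp hsum hz (hunit z hz1)
  have h3 := h1.eq_formalMultilinearSeries h2
  rw [← cauchyPowerSeries_apply f 0 ρ n 1, h3]
  simp [hq]

theorem two_pi_smul_renewalOp_eq_integral {Rn : ℕ → B →L[ℂ] B}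
    (hsum : Summable fun n => ‖Rn (n + 1)‖)
    (hunit : ∀ z : ℂ, ‖z‖ < 1 → IsUnit (1 - renewalSeries Rn z)) {ρ : ℝ} (hρ : 0 < ρ)
    (hρ1 : ρ < 1) (n : ℕ) :
    (2 * Real.pi : ℂ) • renewalOp Rn n = ∫ θ in (0 : ℝ)..2 * Real.pi,
      ((circleMap 0 ρ θ)⁻¹) ^ n • Ring.inverse (1 - renewalSeries Rn (circleMap 0 ρ θ)) := by
  have h := renewalOp_eq_circleIntegral hsum hunit hρ hρ1 n
  rw [circleIntegral] at h
  have hint : ∀ θ : ℝ, deriv (circleMap 0 ρ) θ • (1 / (circleMap 0 ρ θ - 0)) ^ n •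
      (circleMap 0 ρ θ - 0)⁻¹ • Ring.inverse (1 - renewalSeries Rn (circleMap 0 ρ θ)) =
      Complex.I • ((circleMap 0 ρ θ)⁻¹) ^ n •
        Ring.inverse (1 - renewalSeries Rn (circleMap 0 ρ θ)) := by
    intro θ
    have hne : circleMap 0 ρ θ ≠ 0 := by simpa using hρ.ne'
    rw [deriv_circleMap, sub_zero, one_div, smul_smul, smul_smul, smul_smul]
    congr 1
    field_simp
  simp only [hint, intervalIntegral.integral_smul] at h
  rw [h, smul_smul, smul_smul]
  have : (2 * Real.pi : ℂ) * (2 * Real.pi * Complex.I)⁻¹ * Complex.I = 1 := by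
    have : (Real.pi : ℂ) ≠ 0 := by exact_mod_cast Real.pi_ne_zero
    field_simp
  rw [this, one_smul]

theorem circleMap_zero_add_pi_div (ρ θ : ℝ) {n : ℕ} (hn : 1 ≤ n) :
    ((circleMap 0 ρ (θ + Real.pi / n))⁻¹) ^ n = -((circleMap 0 ρ θ)⁻¹) ^ n := by
  have hn0 : (n : ℂ) ≠ 0 := by exact_mod_cast (by omega : n ≠ 0)
  have h : circleMap 0 ρ (θ + Real.pi / n) ^ n = -(circleMap 0 ρ θ) ^ n := by
    rw [circleMap_zero, circleMap_zero, mul_pow, mul_pow, ← Complex.exp_nat_mul,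
      ← Complex.exp_nat_mul]
    have : (n : ℂ) * (((θ + Real.pi / n : ℝ) : ℂ) * Complex.I)
        = n * (θ * Complex.I) + Real.pi * Complex.I := by
      push_cast; field_simp
    rw [this, Complex.exp_add, Complex.exp_pi_mul_I]; ring
  rw [inv_pow, inv_pow, h, inv_neg]

theorem continuous_inverse_renewalSeries_circleMap {Rn : ℕ → B →L[ℂ] B}
    (hsum : Summable fun n => ‖Rn (n + 1)‖)
    (hunit : ∀ z : ℂ, ‖z‖ < 1 → IsUnit (1 - renewalSeries Rn z)) {ρ : ℝ} (hρ : 0 < ρ)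
    (hρ1 : ρ < 1) :
    Continuous fun θ => Ring.inverse (1 - renewalSeries Rn (circleMap 0 ρ θ)) := by
  rw [continuous_iff_continuousAt]
  intro θ
  have h := (differentiableAt_inverse_one_sub_renewalSeries hsum hunit
    (z := circleMap 0 ρ θ) (by simpa [abs_of_pos hρ] using hρ1)).continuousAt
  exact ContinuousAt.comp (f := circleMap 0 ρ) h (continuous_circleMap 0 ρ).continuousAt

/-- Comparing the Fourier integral of `(1 - R)⁻¹` with its translate by `π / n` bounds the renewal
operators by the modulus of continuity of `R` and the `L²` norm of `(1 - R)⁻¹`. -/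
theorem norm_renewalOp_mul_pow_le {Rn : ℕ → B →L[ℂ] B}
    (hsum : Summable fun n => ‖Rn (n + 1)‖)
    (hunit : ∀ z : ℂ, ‖z‖ < 1 → IsUnit (1 - renewalSeries Rn z)) {ρ : ℝ} (hρ : 0 < ρ)
    (hρ1 : ρ < 1) {n : ℕ} (hn : 1 ≤ n) {M : ℝ}
    (hM : ∀ θ : ℝ, ‖renewalSeries Rn (circleMap 0 ρ θ) -
      renewalSeries Rn (circleMap 0 ρ (θ + Real.pi / n))‖ ≤ M) :
    ‖renewalOp Rn n‖ * ρ ^ n ≤ M * ∫ θ in (-Real.pi)..Real.pi,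
      ‖Ring.inverse (1 - renewalSeries Rn (circleMap 0 ρ θ))‖ ^ 2 := by
  set u : ℝ → B →L[ℂ] B := fun θ => Ring.inverse (1 - renewalSeries Rn (circleMap 0 ρ θ)) with hu
  set h := Real.pi / n with hh
  have hM0 : 0 ≤ M := (norm_nonneg _).trans (hM 0)
  have hucont : Continuous u := continuous_inverse_renewalSeries_circleMap hsum hunit hρ hρ1
  have hper : Function.Periodic u (2 * Real.pi) := fun θ => by
    simp only [hu, periodic_circleMap 0 ρ θ]
  have hne : ∀ θ, circleMap 0 ρ θ ≠ 0 := fun θ => by simpa using hρ.ne'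
  have hnorm : ∀ θ, ‖((circleMap 0 ρ θ)⁻¹) ^ n‖ = (ρ ^ n)⁻¹ := fun θ => by
    simp [abs_of_pos hρ]
  set g : ℝ → B →L[ℂ] B := fun θ => ((circleMap 0 ρ θ)⁻¹) ^ n • u θ with hg
  have hgcont : Continuous g :=
    (((continuous_circleMap 0 ρ).inv₀ hne).pow n).smul hucont
  have hgper : Function.Periodic g (2 * Real.pi) := fun θ => by
    simp only [hg, hper θ, periodic_circleMap 0 ρ θ]
  have hT : (2 * Real.pi : ℂ) • renewalOp Rn n = ∫ θ in (0 : ℝ)..2 * Real.pi, g θ :=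
    two_pi_smul_renewalOp_eq_integral hsum hunit hρ hρ1 n
  have hshift : ∫ θ in (0 : ℝ)..2 * Real.pi, g (θ + h) = ∫ θ in (0 : ℝ)..2 * Real.pi, g θ := by
    rw [intervalIntegral.integral_comp_add_right, zero_add, add_comm (2 * Real.pi) h,
      hgper.intervalIntegral_add_eq h 0, zero_add]
  have hdouble : (2 : ℂ) • (2 * Real.pi : ℂ) • renewalOp Rn n =
      ∫ θ in (0 : ℝ)..2 * Real.pi, ((circleMap 0 ρ θ)⁻¹) ^ n • (u θ - u (θ + h)) := by
    rw [two_smul, hT]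
    nth_rewrite 2 [← hshift]
    have hgcont' : Continuous fun θ => g (θ + h) := by fun_prop
    rw [← intervalIntegral.integral_add (hgcont.intervalIntegrable _ _)
      (hgcont'.intervalIntegrable _ _)]
    refine intervalIntegral.integral_congr fun θ _ => ?_
    simp only [hg, hh, circleMap_zero_add_pi_div ρ θ hn, smul_sub, neg_smul]
    abel
  have hdiff : ∀ θ, ‖u θ - u (θ + h)‖ ≤ M * ((‖u θ‖ ^ 2 + ‖u (θ + h)‖ ^ 2) / 2) := by
    intro θ
    have hlt : ∀ θ, ‖circleMap 0 ρ θ‖ < 1 := fun θ => by simpa [abs_of_pos hρ] using hρ1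
    have e : u θ - u (θ + h) = u θ * (renewalSeries Rn (circleMap 0 ρ θ) -
        renewalSeries Rn (circleMap 0 ρ (θ + h))) * u (θ + h) := by
      have e1 := Ring.inverse_mul_cancel _ (hunit _ (hlt θ))
      have e2 := Ring.mul_inverse_cancel _ (hunit _ (hlt (θ + h)))
      calc u θ - u (θ + h) = u θ * ((1 - renewalSeries Rn (circleMap 0 ρ (θ + h))) * u (θ + h))
            - (u θ * (1 - renewalSeries Rn (circleMap 0 ρ θ))) * u (θ + h) := by
            simp only [hu]; rw [e1, e2, mul_one, one_mul]
        _ = _ := by noncomm_ring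
    rw [e]
    calc _ ≤ ‖u θ‖ * M * ‖u (θ + h)‖ := by
          refine (norm_mul_le _ _).trans (mul_le_mul_of_nonneg_right ?_ (norm_nonneg _))
          exact (norm_mul_le _ _).trans (mul_le_mul_of_nonneg_left (hM θ) (norm_nonneg _))
      _ = M * (‖u θ‖ * ‖u (θ + h)‖) := by ring
      _ ≤ _ := by
          gcongr
          nlinarith [sq_nonneg (‖u θ‖ - ‖u (θ + h)‖)]
  have hc1 : Continuous fun θ => ‖u θ‖ ^ 2 := by fun_prop
  have hc2 : Continuous fun θ => ‖u (θ + h)‖ ^ 2 := by fun_prop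
  have hper2 : Function.Periodic (fun θ => ‖u θ‖ ^ 2) (2 * Real.pi) := fun θ => by
    simp only [hper θ]
  have hshift2 : ∫ θ in (0 : ℝ)..2 * Real.pi, ‖u (θ + h)‖ ^ 2 =
      ∫ θ in (0 : ℝ)..2 * Real.pi, ‖u θ‖ ^ 2 := by
    rw [intervalIntegral.integral_comp_add_right (fun θ => ‖u θ‖ ^ 2), zero_add,
      add_comm (2 * Real.pi) h, hper2.intervalIntegral_add_eq h 0, zero_add]
  have hsym : ∫ θ in (-Real.pi)..Real.pi, ‖u θ‖ ^ 2 = ∫ θ in (0 : ℝ)..2 * Real.pi, ‖u θ‖ ^ 2 := by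
    have := hper2.intervalIntegral_add_eq (-Real.pi) 0
    rwa [zero_add, show -Real.pi + 2 * Real.pi = Real.pi by ring] at this
  rw [hsym]
  set J := ∫ θ in (0 : ℝ)..2 * Real.pi, ‖u θ‖ ^ 2 with hJ
  have h2pi : (0 : ℝ) ≤ 2 * Real.pi := by positivity
  have hJ0 : 0 ≤ J := intervalIntegral.integral_nonneg h2pi fun θ _ => by positivity
  have hbound : ‖∫ θ in (0 : ℝ)..2 * Real.pi, ((circleMap 0 ρ θ)⁻¹) ^ n • (u θ - u (θ + h))‖
      ≤ (ρ ^ n)⁻¹ * (M * J) := by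
    refine (intervalIntegral.norm_integral_le_of_norm_le h2pi
      (g := fun θ => (ρ ^ n)⁻¹ * (M * ((‖u θ‖ ^ 2 + ‖u (θ + h)‖ ^ 2) / 2)))
      (Eventually.of_forall fun θ _ => ?_) (Continuous.intervalIntegrable (by fun_prop) _ _)).trans
      (le_of_eq ?_)
    · rw [norm_smul, hnorm]
      exact mul_le_mul_of_nonneg_left (hdiff θ) (by positivity)
    · rw [intervalIntegral.integral_const_mul, intervalIntegral.integral_const_mul,
        intervalIntegral.integral_div, intervalIntegral.integral_add
          (hc1.intervalIntegrable _ _) (hc2.intervalIntegrable _ _), hshift2]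
      congr 2
      ring
  rw [← hdouble, smul_smul, norm_smul] at hbound
  have hcoef : ‖(2 : ℂ) * (2 * Real.pi)‖ = 4 * Real.pi := by
    rw [norm_mul, norm_mul, Complex.norm_real, Real.norm_eq_abs, abs_of_pos Real.pi_pos]
    norm_num; ring
  rw [hcoef, inv_mul_eq_div, le_div_iff₀ (by positivity)] at hbound
  have : 0 ≤ ‖renewalOp Rn n‖ * ρ ^ n := by positivity
  nlinarith [Real.pi_gt_three]

end RenewalSeries

theorem ContinuousLinearMap.map_circleIntegral {E E' : Type*} [NormedAddCommGroup E]
    [NormedSpace ℂ E] [CompleteSpace E] [NormedAddCommGroup E'] [NormedSpace ℂ E']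
    [CompleteSpace E'] (L : E →L[ℂ] E') {f : ℂ → E} {c : ℂ} {r : ℝ}
    (hf : CircleIntegrable f c r) :
    L (∮ ζ in C(c, r), f ζ) = ∮ ζ in C(c, r), L (f ζ) := by
  rw [circleIntegral, circleIntegral, ← L.intervalIntegral_comp_comm hf.out]
  simp only [map_smul]

section Spectral

variable {B : Type*} [NormedAddCommGroup B] [NormedSpace ℂ B] [CompleteSpace B]

/-- If `1` is a simple isolated eigenvalue of `A` with eigenvector `e` and dual eigenvector `m`,
then `1 - A + m ⊗ e` is invertible. -/
theorem IsSimpleIsolatedEigenvalue.isUnit_one_sub_add {A : B →L[ℂ] B}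
    (h : IsSimpleIsolatedEigenvalue A 1) {e : B} {m : B →L[ℂ] ℂ} (hAe : A e = e)
    (hmA : ∀ v, m (A v) = m v) (hme : m e = 1) :
    IsUnit (1 - A + m.smulRight e) := by
  obtain ⟨-, r, hr, hspec, hrank⟩ := h
  set c : ℂ := (2 * Real.pi * Complex.I : ℂ)⁻¹ with hc
  have hpi : (2 * Real.pi * Complex.I : ℂ) ≠ 0 := Complex.two_pi_I_ne_zero
  have hcc : c * (2 * Real.pi * Complex.I) = 1 := inv_mul_cancel₀ hpi
  have hne : ∀ ζ ∈ Metric.sphere (1 : ℂ) r, ζ - 1 ≠ 0 := by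
    intro ζ hζ h0
    rw [mem_sphere_iff_norm, h0, norm_zero] at hζ
    exact hr.ne hζ
  have hres : ∀ ζ ∈ Metric.sphere (1 : ℂ) r, ζ ∈ resolventSet ℂ A := by
    intro ζ hζ
    by_contra hcon
    have : ζ ∈ spectrum ℂ A ∩ Metric.closedBall 1 r :=
      ⟨hcon, Metric.sphere_subset_closedBall hζ⟩
    rw [hspec, Set.mem_singleton_iff] at this
    exact hne ζ hζ (by rw [this, sub_self])
  have hleft : ∀ ζ ∈ Metric.sphere (1 : ℂ) r,
      (algebraMap ℂ (B →L[ℂ] B) ζ - A) * resolvent A ζ = 1 := fun ζ hζ =>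
    Ring.mul_inverse_cancel _ (hres ζ hζ)
  have hright : ∀ ζ ∈ Metric.sphere (1 : ℂ) r,
      resolvent A ζ * (algebraMap ℂ (B →L[ℂ] B) ζ - A) = 1 := fun ζ hζ =>
    Ring.inverse_mul_cancel _ (hres ζ hζ)
  have hAres : ∀ ζ ∈ Metric.sphere (1 : ℂ) r,
      (1 - A) * resolvent A ζ = 1 - (ζ - 1) • resolvent A ζ := by
    intro ζ hζ
    have := hleft ζ hζ
    rw [Algebra.algebraMap_eq_smul_one, sub_mul, smul_mul_assoc, one_mul] at this
    rw [sub_mul, sub_smul, one_mul, one_smul, ← this]; abel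
  have hresA : ∀ ζ ∈ Metric.sphere (1 : ℂ) r,
      resolvent A ζ * (1 - A) = 1 - (ζ - 1) • resolvent A ζ := by
    intro ζ hζ
    have := hright ζ hζ
    rw [Algebra.algebraMap_eq_smul_one, mul_sub, mul_smul_comm, mul_one] at this
    rw [mul_sub, sub_smul, mul_one, one_smul, ← this]; abel
  have hrese : ∀ ζ ∈ Metric.sphere (1 : ℂ) r, resolvent A ζ e = (ζ - 1)⁻¹ • e := by
    intro ζ hζ
    have := congrArg (fun T : B →L[ℂ] B => T e) (hresA ζ hζ)
    simp only [mul_apply_eq_comp, sub_apply,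
      one_apply_eq_self, hAe, sub_self, map_zero, smul_apply] at this
    rw [eq_inv_smul_iff₀ (hne ζ hζ)]
    exact (sub_eq_zero.1 this.symm).symm
  have hmres : ∀ ζ ∈ Metric.sphere (1 : ℂ) r, ∀ v,
      m (resolvent A ζ v) = (ζ - 1)⁻¹ • m v := by
    intro ζ hζ v
    have := congrArg (fun T : B →L[ℂ] B => m (T v)) (hAres ζ hζ)
    simp only [mul_apply_eq_comp, sub_apply, map_sub, hmA,
      one_apply_eq_self, sub_self, smul_apply, map_smul] at this
    rw [eq_inv_smul_iff₀ (hne ζ hζ)]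
    exact (sub_eq_zero.1 this.symm).symm
  have hcont : ContinuousOn (fun ζ : ℂ => resolvent A ζ) (Metric.sphere 1 r) := fun ζ hζ =>
    (spectrum.hasDerivAt_resolvent_const_left (hres ζ hζ)).continuousAt.continuousWithinAt
  have hinvcont : ContinuousOn (fun ζ : ℂ => (ζ - 1)⁻¹) (Metric.sphere 1 r) :=
    ContinuousOn.inv₀ (by fun_prop) hne
  have hint : CircleIntegrable (resolvent A) 1 r := hcont.circleIntegrable hr.le
  have hint' : CircleIntegrable (fun ζ => (ζ - 1)⁻¹ • resolvent A ζ) 1 r :=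
    (hinvcont.smul hcont).circleIntegrable hr.le
  have hone : ∀ {E : Type _} [NormedAddCommGroup E] [NormedSpace ℂ E] [CompleteSpace E] (x : E),
      c • ∮ ζ in C(1, r), (ζ - 1)⁻¹ • x = x := by
    intro E _ _ _ x
    rw [circleIntegral.integral_smul_const, circleIntegral.integral_sub_center_inv _ hr.ne',
      smul_smul, hcc, one_smul]
  have hone' : ∀ x : ℂ, c • ∮ ζ in C(1, r), (ζ - 1)⁻¹ • x = x := by
    intro x
    rw [circleIntegral.integral_smul_const, circleIntegral.integral_sub_center_inv _ hr.ne',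
      smul_smul, hcc, one_smul]
  have hsq : ∮ ζ in C(1, r), ((ζ - 1)⁻¹ * (ζ - 1)⁻¹ : ℂ) = 0 := by
    rw [← circleIntegral.integral_sub_zpow_of_ne (n := -2) (by norm_num) 1 1 r]
    refine circleIntegral.integral_congr hr.le fun ζ _ => ?_
    simp [zpow_neg, pow_two]
  set Q := rieszProjection A 1 r with hQ
  set S : B →L[ℂ] B := c • ∮ ζ in C(1, r), (ζ - 1)⁻¹ • resolvent A ζ with hS
  have hQe : Q e = e := by
    have h1 : Q e = c • (ContinuousLinearMap.apply ℂ B e) (∮ ζ in C(1, r), resolvent A ζ) := rfl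
    rw [h1, ContinuousLinearMap.map_circleIntegral _ hint]
    conv_rhs => rw [← hone e]
    congr 1
    exact circleIntegral.integral_congr hr.le fun ζ hζ => hrese ζ hζ
  have hmQ : ∀ v, m (Q v) = m v := by
    intro v
    have h1 : m (Q v) = c • (m ∘L ContinuousLinearMap.apply ℂ B v)
        (∮ ζ in C(1, r), resolvent A ζ) := by
      simp only [hQ, rieszProjection, ← hc]; simp
    rw [h1, ContinuousLinearMap.map_circleIntegral _ hint]
    conv_rhs => rw [← hone' (m v)]
    congr 1
    exact circleIntegral.integral_congr hr.le fun ζ hζ => hmres ζ hζ v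
  have hQm : ∀ v, Q v = m v • e := by
    obtain ⟨v₀, -, hv₀⟩ := finrank_eq_one_iff'.1 hrank
    intro v
    obtain ⟨s, hs⟩ := hv₀ ⟨Q e, e, rfl⟩
    obtain ⟨t, ht⟩ := hv₀ ⟨Q v, v, rfl⟩
    have hs' : s • (v₀ : B) = e := by
      have := congrArg Subtype.val hs; simpa [hQe] using this
    have ht' : t • (v₀ : B) = Q v := by
      have := congrArg Subtype.val ht; simpa using this
    have hs0 : s ≠ 0 := by
      rintro rfl
      rw [zero_smul] at hs'
      rw [← hs', map_zero] at hme
      exact zero_ne_one hme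
    have hv : (v₀ : B) = s⁻¹ • e := by rw [eq_inv_smul_iff₀ hs0, hs']
    have hQv : Q v = (t * s⁻¹) • e := by rw [← ht', hv, smul_smul]
    have hm : m v = t * s⁻¹ := by rw [← hmQ v, hQv, map_smul, hme, smul_eq_mul, mul_one]
    rw [hQv, hm]
  have hker : ∀ ζ ∈ Metric.sphere (1 : ℂ) r, ∀ T : B →L[ℂ] B,
      T = 1 - (ζ - 1) • resolvent A ζ →
      (ζ - 1)⁻¹ • T = (ζ - 1)⁻¹ • (1 : B →L[ℂ] B) - resolvent A ζ := by
    rintro ζ hζ T rfl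
    rw [smul_sub, smul_smul, inv_mul_cancel₀ (hne ζ hζ), one_smul]
  have hintone : CircleIntegrable (fun ζ : ℂ => (ζ - 1)⁻¹ • (1 : B →L[ℂ] B)) 1 r :=
    (hinvcont.smul continuousOn_const).circleIntegrable hr.le
  have hAS : (1 - A) * S = 1 - Q := by
    have h1 : (1 - A) * S = c • (ContinuousLinearMap.mul ℂ (B →L[ℂ] B) (1 - A))
        (∮ ζ in C(1, r), (ζ - 1)⁻¹ • resolvent A ζ) := by
      simp only [hS, mul_smul_comm, ContinuousLinearMap.mul_apply']
    rw [h1, ContinuousLinearMap.map_circleIntegral _ hint', circleIntegral.integral_congr hr.le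
      (g := fun ζ => (ζ - 1)⁻¹ • (1 : B →L[ℂ] B) - resolvent A ζ),
      circleIntegral.integral_sub hintone hint, smul_sub, hone]
    · rfl
    · intro ζ hζ
      simp only [map_smul, ContinuousLinearMap.mul_apply']
      exact hker ζ hζ _ (hAres ζ hζ)
  have hSA : S * (1 - A) = 1 - Q := by
    have h1 : S * (1 - A) = c • ((ContinuousLinearMap.mul ℂ (B →L[ℂ] B)).flip (1 - A))
        (∮ ζ in C(1, r), (ζ - 1)⁻¹ • resolvent A ζ) := by
      simp only [hS, smul_mul_assoc, ContinuousLinearMap.flip_apply, ContinuousLinearMap.mul_apply']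
    rw [h1, ContinuousLinearMap.map_circleIntegral _ hint', circleIntegral.integral_congr hr.le
      (g := fun ζ => (ζ - 1)⁻¹ • (1 : B →L[ℂ] B) - resolvent A ζ),
      circleIntegral.integral_sub hintone hint, smul_sub, hone]
    · rfl
    · intro ζ hζ
      simp only [map_smul, ContinuousLinearMap.mul_apply', ContinuousLinearMap.flip_apply]
      exact hker ζ hζ _ (hresA ζ hζ)
  have hSe : S e = 0 := by
    have h1 : S e = c • (ContinuousLinearMap.apply ℂ B e)
        (∮ ζ in C(1, r), (ζ - 1)⁻¹ • resolvent A ζ) := rfl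
    rw [h1, ContinuousLinearMap.map_circleIntegral _ hint', circleIntegral.integral_congr hr.le
      (g := fun ζ => ((ζ - 1)⁻¹ * (ζ - 1)⁻¹) • e), circleIntegral.integral_smul_const, hsq,
      zero_smul, smul_zero]
    intro ζ hζ
    simp only [map_smul, ContinuousLinearMap.apply_apply, hrese ζ hζ, smul_smul]
  have hmS : ∀ v, m (S v) = 0 := by
    intro v
    have h1 : m (S v) = c • (m ∘L ContinuousLinearMap.apply ℂ B v)
        (∮ ζ in C(1, r), (ζ - 1)⁻¹ • resolvent A ζ) := by
      simp only [hS]; simp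
    rw [h1, ContinuousLinearMap.map_circleIntegral _ hint', circleIntegral.integral_congr hr.le
      (g := fun ζ => ((ζ - 1)⁻¹ * (ζ - 1)⁻¹) • m v), circleIntegral.integral_smul_const, hsq,
      zero_smul, smul_zero]
    intro ζ hζ
    simp only [map_smul, ContinuousLinearMap.comp_apply, ContinuousLinearMap.apply_apply,
      hmres ζ hζ, smul_smul]
  have hASv : ∀ v, S v - A (S v) = v - m v • e := by
    intro v
    have := congrArg (fun T : B →L[ℂ] B => T v) hAS
    simpa [hQm] using this
  have hSAv : ∀ v, S v - S (A v) = v - m v • e := by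
    intro v
    have := congrArg (fun T : B →L[ℂ] B => T v) hSA
    simpa [hQm] using this
  refine ⟨⟨1 - A + m.smulRight e, S + m.smulRight e, ?_, ?_⟩, rfl⟩
  · ext v
    simp only [mul_apply_eq_comp, add_apply, sub_apply, one_apply_eq_self,
      ContinuousLinearMap.smulRight_apply, map_add, map_smul, hAe, hmS, hme]
    rw [hASv]
    module
  · ext v
    simp only [mul_apply_eq_comp, add_apply, sub_apply, one_apply_eq_self, map_sub,
      ContinuousLinearMap.smulRight_apply, map_add, map_smul, hmA, hSe, hme]
    rw [add_sub_add_right_eq_sub, hSAv]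
    module

end Spectral

theorem norm_one_sub_exp_mul_I_le (x : ℝ) :
    ‖1 - Complex.exp (x * Complex.I)‖ ≤ min 2 |x| := by
  rw [norm_sub_rev, mul_comm]
  refine le_min ?_ Real.norm_exp_I_mul_ofReal_sub_one_le
  refine (norm_sub_le _ _).trans ?_
  rw [Complex.norm_exp_I_mul_ofReal, norm_one]; norm_num

theorem circleMap_zero_pow_eq (ρ θ : ℝ) (k : ℕ) :
    circleMap 0 ρ θ ^ k = ((ρ ^ k : ℝ) : ℂ) * Complex.exp (((k * θ : ℝ) : ℂ) * Complex.I) := by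
  rw [circleMap_zero, mul_pow, ← Complex.exp_nat_mul]
  push_cast
  ring_nf

theorem norm_circleMap_pow_sub_le {ρ : ℝ} (hρ : 0 ≤ ρ) (hρ1 : ρ ≤ 1) (θ : ℝ) {h : ℝ} (hh : 0 ≤ h)
    (k : ℕ) : ‖circleMap 0 ρ θ ^ k - circleMap 0 ρ (θ + h) ^ k‖ ≤ min 2 (k * h) := by
  have e : circleMap 0 ρ θ ^ k - circleMap 0 ρ (θ + h) ^ k =
      circleMap 0 ρ θ ^ k * (1 - Complex.exp (((k * h : ℝ) : ℂ) * Complex.I)) := by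
    rw [circleMap_zero_pow_eq, circleMap_zero_pow_eq, mul_sub, mul_one, mul_assoc,
      ← Complex.exp_add]
    congr 3
    push_cast; ring
  rw [e, norm_mul, norm_pow, norm_circleMap_zero, abs_of_nonneg hρ]
  refine (mul_le_of_le_one_left (norm_nonneg _) (pow_le_one₀ hρ hρ1)).trans ?_
  refine (norm_one_sub_exp_mul_I_le _).trans (le_of_eq ?_)
  rw [abs_of_nonneg (by positivity)]

theorem norm_one_sub_circleMap_pow_le {ρ : ℝ} (hρ : 0 ≤ ρ) (hρ1 : ρ ≤ 1) (θ : ℝ) (k : ℕ) :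
    ‖1 - circleMap 0 ρ θ ^ k‖ ≤ (1 - ρ ^ k) + min 2 (k * |θ|) := by
  have hk : 0 ≤ ρ ^ k := pow_nonneg hρ k
  have hk1 : ρ ^ k ≤ 1 := pow_le_one₀ hρ hρ1
  have e : 1 - circleMap 0 ρ θ ^ k = ((1 - ρ ^ k : ℝ) : ℂ) +
      ((ρ ^ k : ℝ) : ℂ) * (1 - Complex.exp (((k * θ : ℝ) : ℂ) * Complex.I)) := by
    rw [circleMap_zero_pow_eq]; push_cast; ring
  rw [e]
  refine (norm_add_le _ _).trans (add_le_add (le_of_eq ?_) ?_)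
  · rw [Complex.norm_real, Real.norm_eq_abs, abs_of_nonneg (by linarith)]
  · rw [norm_mul, Complex.norm_real, Real.norm_eq_abs, abs_of_nonneg hk]
    refine (mul_le_of_le_one_left (norm_nonneg _) hk1).trans ?_
    refine (norm_one_sub_exp_mul_I_le _).trans (le_of_eq ?_)
    rw [abs_mul, Nat.abs_cast]

theorem re_circleMap_pow (ρ θ : ℝ) (k : ℕ) :
    (1 - circleMap 0 ρ θ ^ k).re = 1 - ρ ^ k * Real.cos (k * |θ|) := by
  rw [circleMap_zero_pow_eq, Complex.sub_re, Complex.one_re, Complex.re_ofReal_mul,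
    Complex.exp_ofReal_mul_I_re, ← Real.cos_abs, abs_mul, Nat.abs_cast]

theorem abs_le_of_norm_circleMap_sub_one_lt {ρ θ δ : ℝ} (hρ : 0 < ρ) (hρ1 : ρ ≤ 1)
    (hθ : |θ| ≤ Real.pi) (h : ‖circleMap 0 ρ θ - 1‖ < δ) : |θ| ≤ Real.pi * δ := by
  have h1 : 1 - ρ ≤ ‖circleMap 0 ρ θ - 1‖ := by
    have := norm_sub_norm_le (1 : ℂ) (circleMap 0 ρ θ)
    rwa [norm_one, norm_circleMap_zero, abs_of_pos hρ, norm_sub_rev] at this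
  have h2 : ‖Complex.exp (Complex.I * θ) - 1‖ ≤ 2 * ‖circleMap 0 ρ θ - 1‖ := by
    have e : Complex.exp (Complex.I * θ) - 1 =
        ((1 - ρ : ℝ) : ℂ) * Complex.exp (Complex.I * θ) + (circleMap 0 ρ θ - 1) := by
      rw [circleMap_zero, mul_comm Complex.I]; push_cast; ring
    rw [e]
    refine (norm_add_le _ _).trans ?_
    rw [norm_mul, Complex.norm_exp_I_mul_ofReal, mul_one, Complex.norm_real, Real.norm_eq_abs,
      abs_of_nonneg (by linarith)]
    linarith
  rw [Complex.norm_exp_I_mul_ofReal_sub_one, norm_mul, Real.norm_eq_abs, Real.norm_eq_abs,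
    abs_two] at h2
  have h3 := Real.mul_abs_le_abs_sin (x := θ / 2) (by rw [abs_div, abs_two]; linarith)
  rw [abs_div, abs_two] at h3
  have h4 : 2 / Real.pi * (|θ| / 2) = |θ| / Real.pi := by ring
  rw [h4, div_le_iff₀ Real.pi_pos] at h3
  nlinarith [Real.pi_pos]

theorem intervalIntegrable_abs_rpow {r : ℝ} (hr : -1 < r) (c : ℝ) :
    IntervalIntegrable (fun x : ℝ => |x| ^ r) volume (-c) c := by
  have h : ∀ c : ℝ, 0 ≤ c → IntervalIntegrable (fun x : ℝ => |x| ^ r) volume 0 c := by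
    intro c hc
    refine (intervalIntegral.intervalIntegrable_rpow' hr).congr fun x hx => ?_
    rw [Set.uIoc_of_le hc] at hx
    simp only [abs_of_pos hx.1]
  have h' : ∀ c : ℝ, 0 ≤ c → IntervalIntegrable (fun x : ℝ => |x| ^ r) volume (-c) c := by
    intro c hc
    have h1 := (IntervalIntegrable.iff_comp_neg (by simp)).1 (h c hc)
    simp only [abs_neg, neg_zero] at h1
    exact h1.symm.trans (h c hc)
  rcases le_total 0 c with hc | hc
  · exact h' c hc
  · have := (h' (-c) (by linarith)).symm
    rwa [neg_neg] at this

section Resolvent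

variable {B : Type*} [NormedAddCommGroup B] [NormedSpace ℂ B]

/-- Solving `(1 - A) v = u` through the invertible rank-one perturbation `1 - A + m ⊗ e`. -/
theorem norm_inverse_one_sub_le {A : B →L[ℂ] B} {e : B} {m : B →L[ℂ] ℂ} (hA : IsUnit (1 - A))
    (hAP : IsUnit (1 - A + m.smulRight e)) {K d : ℝ} (hK : 0 ≤ K) (hd : 0 < d)
    (hinv : ‖Ring.inverse (1 - A + m.smulRight e)‖ ≤ K)
    (hlow : d ≤ ‖1 - m (Ring.inverse (1 - A + m.smulRight e) e)‖) :
    ‖Ring.inverse (1 - A)‖ ≤ K + K * ‖m‖ * (K * ‖e‖) / d := by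
  set V := Ring.inverse (1 - A + m.smulRight e) with hV
  refine ContinuousLinearMap.opNorm_le_bound _ (by positivity) fun u => ?_
  set v := Ring.inverse (1 - A) u with hv
  have h1 : (1 - A) v = u := by
    have := congrArg (fun T : B →L[ℂ] B => T u) (Ring.mul_inverse_cancel _ hA)
    simpa only [mul_apply_eq_comp, one_apply_eq_self] using this
  have h2 : (1 - A + m.smulRight e) v = u + m v • e := by
    rw [add_apply, h1, ContinuousLinearMap.smulRight_apply]
  have h3 : v = V u + m v • V e := by
    rw [← map_smul, ← map_add, ← h2]
    have := congrArg (fun T : B →L[ℂ] B => T v) (Ring.inverse_mul_cancel _ hAP)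
    simpa only [mul_apply_eq_comp, one_apply_eq_self] using this.symm
  have h4 : m v * (1 - m (V e)) = m (V u) := by
    have := congrArg m h3
    rw [map_add, map_smul, smul_eq_mul] at this
    linear_combination this
  have hVu : ‖V u‖ ≤ K * ‖u‖ := V.le_of_opNorm_le hinv u
  have hVe : ‖V e‖ ≤ K * ‖e‖ := V.le_of_opNorm_le hinv e
  have h5 : ‖m v‖ ≤ ‖m‖ * (K * ‖u‖) / d := by
    rw [le_div_iff₀ hd]
    calc ‖m v‖ * d ≤ ‖m v‖ * ‖1 - m (V e)‖ := by gcongr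
      _ = ‖m (V u)‖ := by rw [← norm_mul, h4]
      _ ≤ ‖m‖ * ‖V u‖ := m.le_opNorm _
      _ ≤ _ := by gcongr
  calc ‖v‖ ≤ ‖V u‖ + ‖m v • V e‖ := by
        nth_rewrite 1 [h3]; exact norm_add_le _ _
    _ ≤ K * ‖u‖ + ‖m‖ * (K * ‖u‖) / d * (K * ‖e‖) := by
        rw [norm_smul]; gcongr
    _ = _ := by ring

variable [CompleteSpace B]

theorem norm_renewalSeries_circleMap_sub_le {Rn : ℕ → B →L[ℂ] B} {a : ℕ → ℝ} (ha : Antitone a)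
    (hpos : ∀ n, 0 < a n) {C : ℝ}
    (hRn : ∀ k, ‖Rn (k + 1)‖ ≤ C * (a k - a (k + 1)))
    (hsum : Summable fun n => ‖Rn (n + 1)‖) {ρ : ℝ} (hρ : 0 ≤ ρ) (hρ1 : ρ ≤ 1) (θ : ℝ) {h : ℝ}
    (hh : 0 ≤ h) :
    ‖renewalSeries Rn (circleMap 0 ρ θ) - renewalSeries Rn (circleMap 0 ρ (θ + h))‖ ≤
      C * ∑' k : ℕ, min 2 ((k + 1) * h) * (a k - a (k + 1)) := by
  have hle : ∀ θ, ‖circleMap 0 ρ θ‖ ≤ 1 := fun θ => by simpa [abs_of_nonneg hρ] using hρ1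
  have h1 := (hasSum_renewalSeries hsum (hle θ)).sub (hasSum_renewalSeries hsum (hle (θ + h)))
  have hs := summable_mul_sub_succ_of_antitone ha hpos
    (g := fun k : ℕ => min 2 ((k + 1) * h)) fun k => abs_min_two_le (by positivity)
  rw [← h1.tsum_eq, ← tsum_mul_left]
  refine tsum_of_norm_bounded (hs.mul_left C).hasSum fun k => ?_
  rw [← sub_smul, norm_smul]
  have h2 := norm_circleMap_pow_sub_le hρ hρ1 θ hh (k + 1)
  push_cast at h2
  calc _ ≤ min 2 ((k + 1) * h) * (C * (a k - a (k + 1))) :=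
        mul_le_mul h2 (hRn k) (norm_nonneg _) (le_min (by norm_num) (by positivity))
    _ = _ := by ring

variable {Rn : ℕ → B →L[ℂ] B} {a : ℕ → ℝ} {e : B} {m : B →L[ℂ] ℂ}

theorem hasSum_functional_sub_renewalSeries (hsum : Summable fun n => ‖Rn (n + 1)‖)
    (hmA : ∀ v, m (renewalSeries Rn 1 v) = m v) {z : ℂ} (hz : ‖z‖ ≤ 1) (v : B) :
    HasSum (fun k => (1 - z ^ (k + 1)) * m (Rn (k + 1) v)) (m v - m (renewalSeries Rn z v)) := by
  have h : ∀ z : ℂ, ‖z‖ ≤ 1 → HasSum (fun k => z ^ (k + 1) * m (Rn (k + 1) v))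
      (m (renewalSeries Rn z v)) := fun z hz =>
    (hasSum_renewalSeries hsum hz).mapL (m ∘L ContinuousLinearMap.apply ℂ B v) |>.congr_fun
      fun k => by simp
  have h1 := h 1 (by simp)
  rw [hmA] at h1
  simpa [sub_mul] using h1.sub (h z hz)

/-- If `A = 1 - R(z) + m ⊗ e` and `A⁻¹ e` is close to `e`, then `1 - m (A⁻¹ e)` is bounded below by the
real part of the characteristic function of the weights `a k - a (k + 1)`. -/
theorem le_norm_one_sub_functional (ha : Antitone a) (hpos : ∀ n, 0 < a n)
    (hsum : Summable fun n => ‖Rn (n + 1)‖)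
    (hmR : ∀ k v, ‖m (Rn (k + 1) v)‖ ≤ (a k - a (k + 1)) * ‖v‖)
    (hmRe : ∀ k, m (Rn (k + 1) e) = ((a k - a (k + 1) : ℝ) : ℂ))
    (hmA : ∀ v, m (renewalSeries Rn 1 v) = m v) (hme : m e = 1)
    {K ρ θ : ℝ} (hK : 0 < K) (hρ : 0 < ρ) (hρ1 : ρ ≤ 1)
    (hG : ∑' k : ℕ, min 2 ((k + 1) * |θ|) * (a k - a (k + 1)) ≤
      K * ∑' k : ℕ, (1 - Real.cos ((k + 1) * |θ|)) * (a k - a (k + 1)))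
    (hunit : IsUnit (1 - renewalSeries Rn (circleMap 0 ρ θ) + m.smulRight e))
    (hclose : ‖Ring.inverse (1 - renewalSeries Rn (circleMap 0 ρ θ) + m.smulRight e) e - e‖ ≤
      1 / (2 * (1 + 2 * K))) :
    (∑' k : ℕ, (1 - Real.cos ((k + 1) * |θ|)) * (a k - a (k + 1))) / 4 ≤
      ‖1 - m (Ring.inverse (1 - renewalSeries Rn (circleMap 0 ρ θ) + m.smulRight e) e)‖ := by
  set z := circleMap 0 ρ θ with hz
  set x := Ring.inverse (1 - renewalSeries Rn z + m.smulRight e) e with hx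
  have hz1 : ‖z‖ ≤ 1 := by simpa [hz, abs_of_pos hρ] using hρ1
  have hw : ∀ k, 0 ≤ a k - a (k + 1) := fun k => sub_nonneg.2 (ha k.le_succ)
  have hρk : ∀ k : ℕ, 0 ≤ ρ ^ k := fun k => pow_nonneg hρ.le k
  have hρk1 : ∀ k : ℕ, ρ ^ k ≤ 1 := fun k => pow_le_one₀ hρ.le hρ1
  have hx1 : 1 - m x = m x - m (renewalSeries Rn z x) := by
    have h1 := congrArg (fun T : B →L[ℂ] B => m (T e)) (Ring.mul_inverse_cancel _ hunit)
    simp only [mul_apply_eq_comp, one_apply_eq_self, add_apply, sub_apply,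
      ContinuousLinearMap.smulRight_apply, map_add, map_sub, map_smul, smul_eq_mul, hme,
      mul_one, ← hx] at h1
    linear_combination -h1
  set D := ∑' k : ℕ, (1 - z ^ (k + 1)).re * (a k - a (k + 1)) with hD
  have hre : ∀ k : ℕ, (1 - z ^ (k + 1)).re = 1 - ρ ^ (k + 1) * Real.cos ((k + 1) * |θ|) := by
    intro k; rw [hz, re_circleMap_pow]; push_cast; rfl
  have hnorm2 : ∀ k : ℕ, ‖1 - z ^ (k + 1)‖ ≤ 2 := fun k => by
    refine (norm_sub_le _ _).trans ?_
    rw [norm_one, norm_pow]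
    linarith [pow_le_one₀ (norm_nonneg z) hz1 (n := k + 1)]
  have hsD := summable_mul_sub_succ_of_antitone ha hpos
    (g := fun k : ℕ => (1 - z ^ (k + 1)).re) fun k =>
      (Complex.abs_re_le_norm _).trans (hnorm2 k)
  have hsC := summable_mul_sub_succ_of_antitone ha hpos
    (g := fun k : ℕ => 1 - Real.cos ((k + 1) * |θ|)) fun k => abs_one_sub_cos_le _
  have hsG := summable_mul_sub_succ_of_antitone ha hpos
    (g := fun k : ℕ => min 2 ((k + 1) * |θ|)) fun k => abs_min_two_le (by positivity)
  have hsN := summable_mul_sub_succ_of_antitone ha hpos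
    (g := fun k : ℕ => ‖1 - z ^ (k + 1)‖) fun k => by rw [abs_norm]; exact hnorm2 k
  set S := ∑' k : ℕ, (1 - Real.cos ((k + 1) * |θ|)) * (a k - a (k + 1)) with hS
  have hS0 : 0 ≤ S := tsum_nonneg fun k =>
    mul_nonneg (by linarith [Real.cos_le_one ((k + 1) * |θ|)]) (hw k)
  have hSD : S ≤ 2 * D := by
    rw [hS, hD, ← tsum_mul_left]
    refine hsC.tsum_le_tsum (fun k => ?_) (hsD.mul_left 2)
    rw [← mul_assoc]
    refine mul_le_mul_of_nonneg_right ?_ (hw k)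
    rw [hre]
    have h1 := hρk (k + 1)
    have h2 := hρk1 (k + 1)
    have h3 := Real.cos_le_one ((k + 1) * |θ|)
    have h4 := Real.neg_one_le_cos ((k + 1) * |θ|)
    nlinarith
  have hN : ∑' k : ℕ, ‖1 - z ^ (k + 1)‖ * (a k - a (k + 1)) ≤ (1 + 2 * K) * D := by
    have h1 : ∑' k : ℕ, ‖1 - z ^ (k + 1)‖ * (a k - a (k + 1)) ≤
        D + ∑' k : ℕ, min 2 ((k + 1) * |θ|) * (a k - a (k + 1)) := by
      rw [hD, ← hsD.tsum_add hsG]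
      refine hsN.tsum_le_tsum (fun k => ?_) (hsD.add hsG)
      rw [← add_mul]
      refine mul_le_mul_of_nonneg_right ?_ (hw k)
      have h2 := norm_one_sub_circleMap_pow_le hρ.le hρ1 θ (k + 1)
      push_cast at h2
      refine h2.trans (add_le_add_left ?_ _)
      rw [hre]
      have := mul_le_of_le_one_right (hρk (k + 1)) (Real.cos_le_one ((k + 1) * |θ|))
      linarith
    have h2 : K * S ≤ K * (2 * D) := mul_le_mul_of_nonneg_left hSD hK.le
    linarith
  have hD0 : 0 ≤ D := by linarith
  have hdecomp : m x - m (renewalSeries Rn z x) =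
      (m e - m (renewalSeries Rn z e)) + (m (x - e) - m (renewalSeries Rn z (x - e))) := by
    simp only [map_sub]; ring
  have hmain : D ≤ ‖m e - m (renewalSeries Rn z e)‖ := by
    have h1 := hasSum_functional_sub_renewalSeries hsum hmA hz1 e
    have h2 := Complex.hasSum_re h1
    have h3 : D = (m e - m (renewalSeries Rn z e)).re := by
      rw [hD, ← h2.tsum_eq]
      refine tsum_congr fun k => ?_
      rw [hmRe, Complex.re_mul_ofReal]
    rw [h3]
    exact Complex.re_le_norm _
  have herr : ‖m (x - e) - m (renewalSeries Rn z (x - e))‖ ≤ D / 2 := by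
    have h1 := hasSum_functional_sub_renewalSeries hsum hmA hz1 (x - e)
    have h2 : ‖m (x - e) - m (renewalSeries Rn z (x - e))‖ ≤
        (∑' k : ℕ, ‖1 - z ^ (k + 1)‖ * (a k - a (k + 1))) * ‖x - e‖ := by
      rw [← h1.tsum_eq]
      refine tsum_of_norm_bounded (hsN.hasSum.mul_right ‖x - e‖) fun k => ?_
      rw [norm_mul, mul_assoc]
      exact mul_le_mul_of_nonneg_left (hmR k _) (norm_nonneg _)
    refine h2.trans ((mul_le_mul hN hclose (norm_nonneg _) (by positivity)).trans (le_of_eq ?_))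
    field_simp
  rw [hx1, hdecomp]
  have h6 := norm_sub_le_norm_add (m e - m (renewalSeries Rn z e))
    (m (x - e) - m (renewalSeries Rn z (x - e)))
  linarith

theorem exists_norm_inverse_one_sub_renewalSeries_le (ha : Antitone a) (hpos : ∀ n, 0 < a n)
    (hsum : Summable fun n => ‖Rn (n + 1)‖)
    (hmR : ∀ k v, ‖m (Rn (k + 1) v)‖ ≤ (a k - a (k + 1)) * ‖v‖)
    (hmRe : ∀ k, m (Rn (k + 1) e) = ((a k - a (k + 1) : ℝ) : ℂ))
    (hmA : ∀ v, m (renewalSeries Rn 1 v) = m v) (hme : m e = 1)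
    (hAe : renewalSeries Rn 1 e = e)
    (hunit1 : IsUnit (1 - renewalSeries Rn 1 + m.smulRight e))
    (hunit : ∀ z : ℂ, ‖z‖ ≤ 1 → z ≠ 1 → IsUnit (1 - renewalSeries Rn z))
    {K θ₀ p : ℝ} (hK : 0 < K) (hθ₀ : 0 < θ₀) (hp : 0 < p)
    (hG : ∀ θ : ℝ, 0 < θ → θ ≤ θ₀ →
      ∑' k : ℕ, min 2 ((k + 1) * θ) * (a k - a (k + 1)) ≤
        K * ∑' k : ℕ, (1 - Real.cos ((k + 1) * θ)) * (a k - a (k + 1)) ∧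
      θ ^ p ≤ K * ∑' k : ℕ, (1 - Real.cos ((k + 1) * θ)) * (a k - a (k + 1))) :
    ∃ C : ℝ, 0 < C ∧ ∀ ρ θ : ℝ, 0 < ρ → ρ < 1 → |θ| ≤ Real.pi → θ ≠ 0 →
      ‖Ring.inverse (1 - renewalSeries Rn (circleMap 0 ρ θ))‖ ≤ C * |θ| ^ (-p) := by
  set W : ℂ → B →L[ℂ] B := fun z => 1 - renewalSeries Rn z + m.smulRight e with hW
  have hRcont := continuousOn_renewalSeries hsum
  have h1mem : (1 : ℂ) ∈ Metric.closedBall (0 : ℂ) 1 := by simp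
  have hWcont : ContinuousWithinAt W (Metric.closedBall 0 1) 1 :=
    ((continuousOn_const.sub hRcont).add continuousOn_const) 1 h1mem
  have hW1 : IsUnit (W 1) := hunit1
  have hinvcont : ContinuousWithinAt (fun z => Ring.inverse (W z)) (Metric.closedBall 0 1) 1 :=
    ContinuousAt.comp_continuousWithinAt (f := W) (g := Ring.inverse)
      (NormedRing.inverse_continuousAt hW1.unit) hWcont
  have hW1e : Ring.inverse (W 1) e = e := by
    have h1 : W 1 e = e := by
      simp [hW, hAe, hme]
    have h2 := congrArg (fun T : B →L[ℂ] B => T e) (Ring.inverse_mul_cancel _ hW1)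
    simp only [mul_apply_eq_comp, one_apply_eq_self, h1] at h2
    exact h2
  set κ := ‖Ring.inverse (W 1)‖ + 1 with hκ
  have hev1 : ∀ᶠ z in 𝓝[Metric.closedBall 0 1] (1 : ℂ), IsUnit (W z) :=
    hWcont.eventually (Units.isOpen.mem_nhds hW1)
  have hev2 : ∀ᶠ z in 𝓝[Metric.closedBall 0 1] (1 : ℂ), ‖Ring.inverse (W z)‖ < κ :=
    hinvcont.norm.eventually (gt_mem_nhds (by linarith))
  have hev3 : ∀ᶠ z in 𝓝[Metric.closedBall 0 1] (1 : ℂ),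
      ‖Ring.inverse (W z) e - e‖ < 1 / (2 * (1 + 2 * K)) := by
    have hc : ContinuousWithinAt (fun z => ‖Ring.inverse (W z) e - e‖)
        (Metric.closedBall 0 1) 1 :=
      ((hinvcont.clm_apply continuousWithinAt_const).sub continuousWithinAt_const).norm
    refine hc.eventually (gt_mem_nhds ?_)
    simp only [hW1e, sub_self, norm_zero]
    positivity
  obtain ⟨δ₁, hδ₁, hnear⟩ := Metric.mem_nhdsWithin_iff.1 (hev1.and (hev2.and hev3))
  set δ := min δ₁ (θ₀ / Real.pi) with hδ
  have hδ0 : 0 < δ := lt_min hδ₁ (div_pos hθ₀ Real.pi_pos)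
  have hcomp : IsCompact (Metric.closedBall (0 : ℂ) 1 \ Metric.ball 1 δ) :=
    (isCompact_closedBall 0 1).diff Metric.isOpen_ball
  have hfar : ContinuousOn (fun z => Ring.inverse (1 - renewalSeries Rn z))
      (Metric.closedBall (0 : ℂ) 1 \ Metric.ball 1 δ) := by
    intro z hz
    have hz1 : z ≠ 1 := by
      rintro rfl; exact hz.2 (Metric.mem_ball_self hδ0)
    have hu := hunit z (by simpa using hz.1) hz1
    have hc : ContinuousWithinAt (fun z => 1 - renewalSeries Rn z)
        (Metric.closedBall (0 : ℂ) 1 \ Metric.ball 1 δ) z :=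
      (continuousOn_const.sub (hRcont.mono Set.sdiff_subset)) z hz
    exact ContinuousAt.comp_continuousWithinAt (g := Ring.inverse)
      (NormedRing.inverse_continuousAt hu.unit) hc
  obtain ⟨M, hM⟩ := hcomp.exists_bound_of_continuousOn hfar
  have hM0 : 0 ≤ |M| := abs_nonneg M
  have hκ0 : 0 < κ := by positivity
  refine ⟨(|M| + κ) * Real.pi ^ p + κ * ‖m‖ * (κ * ‖e‖) * (4 * K) , by positivity,
    fun ρ θ hρ hρ1 hθ hθ0 => ?_⟩
  have hθpos : 0 < |θ| := abs_pos.2 hθ0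
  have hzle : ‖circleMap 0 ρ θ‖ ≤ 1 := by simpa [abs_of_pos hρ] using hρ1.le
  have hzlt : ‖circleMap 0 ρ θ‖ < 1 := by simpa [abs_of_pos hρ] using hρ1
  have hz1 : circleMap 0 ρ θ ≠ 1 := by
    intro h; rw [h, norm_one] at hzlt; exact lt_irrefl _ hzlt
  have hπ : 1 ≤ Real.pi ^ p * |θ| ^ (-p) := by
    rw [Real.rpow_neg hθpos.le, ← div_eq_mul_inv, one_le_div (by positivity)]
    exact Real.rpow_le_rpow hθpos.le hθ hp.le
  have hX0 : 0 ≤ κ * ‖m‖ * (κ * ‖e‖) * (4 * K) * |θ| ^ (-p) := by positivity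
  by_cases hz : circleMap 0 ρ θ ∈ Metric.ball (1 : ℂ) δ
  · have hz' := hz
    rw [mem_ball_iff_norm] at hz'
    have hθle : |θ| ≤ θ₀ := by
      refine (abs_le_of_norm_circleMap_sub_one_lt hρ hρ1.le hθ hz').trans ?_
      rw [mul_comm, ← le_div_iff₀ Real.pi_pos]
      exact min_le_right _ _
    obtain ⟨hn1, hn2, hn3⟩ := hnear ⟨Metric.ball_subset_ball (min_le_left _ _) hz,
      by simpa using hzle⟩
    obtain ⟨hg1, hg2⟩ := hG |θ| hθpos hθle
    have hlow := le_norm_one_sub_functional ha hpos hsum hmR hmRe hmA hme hK hρ hρ1.le hg1 hn1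
      hn3.le
    have hd : |θ| ^ p / (4 * K) ≤
        ‖1 - m (Ring.inverse (1 - renewalSeries Rn (circleMap 0 ρ θ) + m.smulRight e) e)‖ := by
      refine le_trans ?_ hlow
      rw [div_le_div_iff₀ (by positivity) (by norm_num)]
      linarith
    have := norm_inverse_one_sub_le (hunit _ hzle hz1) hn1 hκ0.le
      (d := |θ| ^ p / (4 * K)) (by positivity) hn2.le hd
    refine this.trans ?_
    have e1 : κ * ‖m‖ * (κ * ‖e‖) / (|θ| ^ p / (4 * K)) =
        κ * ‖m‖ * (κ * ‖e‖) * (4 * K) * |θ| ^ (-p) := by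
      rw [Real.rpow_neg hθpos.le]; field_simp
    rw [e1]
    nlinarith
  · have := hM _ ⟨by simpa using hzle, hz⟩
    have h2 := le_abs_self M
    refine this.trans ?_
    nlinarith

/-- The upper bound for renewal operators, in terms of an invariant functional `m` and an
invariant vector `e`. -/
theorem exists_norm_renewalOp_le {β : ℝ} (ha : Antitone a) (hpos : ∀ n, 0 < a n)
    (hβ : 0 < β) (hβ' : β < 1 / 2)
    (hlim : Tendsto (fun n => a (2 * n) / a n) atTop (𝓝 ((2 : ℝ) ^ (-β))))
    {C : ℝ} (hC : 0 < C) (hRn : ∀ k, ‖Rn (k + 1)‖ ≤ C * (a k - a (k + 1)))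
    (hmR : ∀ k v, ‖m (Rn (k + 1) v)‖ ≤ (a k - a (k + 1)) * ‖v‖)
    (hmRe : ∀ k, m (Rn (k + 1) e) = ((a k - a (k + 1) : ℝ) : ℂ))
    (hmA : ∀ v, m (renewalSeries Rn 1 v) = m v) (hme : m e = 1)
    (hAe : renewalSeries Rn 1 e = e)
    (hsimple : IsSimpleIsolatedEigenvalue (renewalSeries Rn 1) 1)
    (hunit : ∀ z : ℂ, ‖z‖ ≤ 1 → z ≠ 1 → IsUnit (1 - renewalSeries Rn z)) :
    ∃ C' : ℝ, 0 < C' ∧ ∀ n : ℕ, 1 ≤ n → ‖renewalOp Rn n‖ ≤ C' * a n := by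
  have hsum : Summable fun n => ‖Rn (n + 1)‖ :=
    ((summable_sub_succ_of_antitone ha hpos).mul_left C).of_nonneg_of_le
      (fun _ => norm_nonneg _) hRn
  obtain ⟨p, hβp, hp⟩ := exists_between hβ'
  obtain ⟨K, hK, hG, θ₀, hθ₀, hlow⟩ := exists_le_tsum_one_sub_cos ha hpos hβ hβp hp.le hlim
  obtain ⟨D, hD, hDle⟩ := exists_norm_inverse_one_sub_renewalSeries_le ha hpos hsum hmR hmRe hmA
    hme hAe (hsimple.isUnit_one_sub_add hAe hmA hme) hunit hK hθ₀ (hβ.trans hβp) hlow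
  have hunit' : ∀ z : ℂ, ‖z‖ < 1 → IsUnit (1 - renewalSeries Rn z) := fun z hz =>
    hunit z hz.le (by rintro rfl; simp at hz)
  set J := ∫ θ in (-Real.pi)..Real.pi, D ^ 2 * |θ| ^ (-(2 * p)) with hJ
  have hJ0 : 0 ≤ J := intervalIntegral.integral_nonneg (by linarith [Real.pi_pos])
    fun θ _ => by positivity
  have hJle : ∀ ρ : ℝ, 0 < ρ → ρ < 1 → ∫ θ in (-Real.pi)..Real.pi,
      ‖Ring.inverse (1 - renewalSeries Rn (circleMap 0 ρ θ))‖ ^ 2 ≤ J := by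
    intro ρ hρ hρ1
    have hcont : Continuous fun θ =>
        ‖Ring.inverse (1 - renewalSeries Rn (circleMap 0 ρ θ))‖ ^ 2 :=
      (continuous_inverse_renewalSeries_circleMap hsum hunit' hρ hρ1).norm.pow 2
    refine intervalIntegral.integral_mono_ae_restrict (by linarith [Real.pi_pos])
      (hcont.intervalIntegrable _ _)
      ((intervalIntegrable_abs_rpow (by linarith) Real.pi).const_mul _) ?_
    have hne : ∀ᵐ θ : ℝ ∂volume.restrict (Set.Icc (-Real.pi) Real.pi), θ ≠ 0 :=
      ae_restrict_of_ae (by simp [ae_iff])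
    filter_upwards [hne, ae_restrict_mem measurableSet_Icc] with θ hθ0 hθ
    have h1 := hDle ρ θ hρ hρ1 (abs_le.2 hθ) hθ0
    refine (pow_le_pow_left₀ (norm_nonneg _) h1 2).trans (le_of_eq ?_)
    rw [mul_pow, ← Real.rpow_natCast (|θ| ^ (-p)), ← Real.rpow_mul (abs_nonneg _)]
    congr 2
    push_cast; ring
  refine ⟨C * K * J + 1, by positivity, fun n hn => ?_⟩
  have hn0 : (0 : ℝ) < n := by exact_mod_cast hn
  have hbound : ∀ ρ : ℝ, 0 < ρ → ρ < 1 → ‖renewalOp Rn n‖ * ρ ^ n ≤ C * (K * a n) * J := by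
    intro ρ hρ hρ1
    have h1 := norm_renewalOp_mul_pow_le hsum hunit' hρ hρ1 hn (M := C * (K * a n)) fun θ => ?_
    · exact h1.trans (mul_le_mul_of_nonneg_left (hJle ρ hρ hρ1)
        (mul_pos hC (mul_pos hK (hpos n))).le)
    · refine (norm_renewalSeries_circleMap_sub_le ha hpos hRn hsum hρ.le hρ1.le θ
        (by positivity)).trans ?_
      refine mul_le_mul_of_nonneg_left (hG n _ hn (by positivity) ?_) hC.le
      rw [div_mul_cancel₀ _ hn0.ne']
      exact Real.pi_le_four
  have hlim1 : Tendsto (fun ρ : ℝ => ‖renewalOp Rn n‖ * ρ ^ n) (𝓝[<] 1)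
      (𝓝 (‖renewalOp Rn n‖ * 1 ^ n)) := by
    have : Continuous fun ρ : ℝ => ‖renewalOp Rn n‖ * ρ ^ n := by fun_prop
    exact (this.tendsto 1).mono_left nhdsWithin_le_nhds
  rw [one_pow, mul_one] at hlim1
  have hfin := le_of_tendsto hlim1 (b := C * (K * a n) * J) (by
    filter_upwards [Ioo_mem_nhdsLT (zero_lt_one' ℝ)] with ρ hρ
    exact hbound ρ hρ.1 hρ.2)
  have := hpos n
  linarith

end Resolvent

section TransferFunctionals

variable {Y : Type*} [MeasurableSpace Y] {μ : Measure Y} [IsProbabilityMeasure μ]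

theorem integrable_coe_linfty (f : Lp ℂ ∞ μ) : Integrable f μ :=
  memLp_one_iff_integrable.1 ((Lp.memLp f).mono_exponent le_top)

theorem norm_setIntegral_linfty_le (f : Lp ℂ ∞ μ) (s : Set Y) :
    ‖∫ y in s, f y ∂μ‖ ≤ μ.real s * ‖f‖ := by
  rw [mul_comm]
  refine norm_setIntegral_le_of_norm_le_const_ae (measure_lt_top μ s) ?_
  refine ae_restrict_of_ae ?_
  filter_upwards [ae_le_eLpNormEssSup (f := f) (μ := μ)] with y hy
  rw [Lp.norm_def, eLpNorm_exponent_top, ← toReal_enorm]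
  refine ENNReal.toReal_mono ?_ hy
  rw [← eLpNorm_exponent_top]
  exact Lp.eLpNorm_ne_top f

variable {B : Type*} [NormedAddCommGroup B] [NormedSpace ℂ B]

/-- The functional `v ↦ ∫_s v dμ` on a space of bounded functions. -/
noncomputable def setIntegralFunctional (ι : B →ₗ[ℂ] Lp ℂ ∞ μ) (hι : ∀ v : B, ‖ι v‖ ≤ ‖v‖)
    (s : Set Y) : B →L[ℂ] ℂ :=
  LinearMap.mkContinuous
    { toFun := fun v => ∫ y in s, ι v y ∂μ
      map_add' := fun v w => by
        rw [map_add, ← integral_add (integrable_coe_linfty _).integrableOn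
          (integrable_coe_linfty _).integrableOn]
        exact integral_congr_ae (ae_restrict_of_ae (Lp.coeFn_add _ _))
      map_smul' := fun c v => by
        rw [map_smul, RingHom.id_apply, ← integral_smul]
        exact integral_congr_ae (ae_restrict_of_ae (Lp.coeFn_smul _ _)) }
    1 fun v => by
      refine (norm_setIntegral_linfty_le (ι v) s).trans ?_
      exact mul_le_mul measureReal_le_one (hι v) (norm_nonneg _) zero_le_one

theorem setIntegralFunctional_apply (ι : B →ₗ[ℂ] Lp ℂ ∞ μ) (hι : ∀ v : B, ‖ι v‖ ≤ ‖v‖)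
    (s : Set Y) (v : B) : setIntegralFunctional ι hι s v = ∫ y in s, ι v y ∂μ := rfl

variable {F : Y → Y} {φ : Y → ℕ} {R : Lp ℂ 1 μ →L[ℂ] Lp ℂ 1 μ} {ι : B →ₗ[ℂ] Lp ℂ ∞ μ}
  {Rn : ℕ → B →L[ℂ] B}

theorem coeFn_linftyToL1 (f : Lp ℂ ∞ μ) : linftyToL1 μ f =ᵐ[μ] f := MemLp.coeFn_toLp _

theorem setIntegral_transfer_cutoff (hF : MeasurePreserving F μ μ) (hφ : Measurable φ)
    (hR : IsTransferOperator μ F R)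
    (hRn : ∀ n : ℕ, 1 ≤ n → ∀ v : B,
      linftyToL1 μ (ι (Rn n v)) = R (cutoff μ hφ n (linftyToL1 μ (ι v))))
    {s : Set Y} (hs : MeasurableSet s) {n : ℕ} (hn : 1 ≤ n) (v : B) :
    ∫ y in s, ι (Rn n v) y ∂μ = ∫ y in φ ⁻¹' {n} ∩ F ⁻¹' s, ι v y ∂μ := by
  have hφn : MeasurableSet (φ ⁻¹' {n}) := hφ (measurableSet_singleton n)
  set w : Lp ℂ ∞ μ := indicatorConstLp ∞ hs (measure_ne_top μ s) (1 : ℂ) with hw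
  have hwae : w =ᵐ[μ] s.indicator fun _ => (1 : ℂ) := indicatorConstLp_coeFn
  have hwF : (fun y => w (F y)) =ᵐ[μ] fun y => s.indicator (fun _ => (1 : ℂ)) (F y) :=
    hF.quasiMeasurePreserving.ae_eq hwae
  have key := hR (cutoff μ hφ n (linftyToL1 μ (ι v))) w
  rw [← hRn n hn v] at key
  have hl : ∫ y, linftyToL1 μ (ι (Rn n v)) y * w y ∂μ = ∫ y in s, ι (Rn n v) y ∂μ := by
    rw [← integral_indicator hs]
    refine integral_congr_ae ?_
    filter_upwards [coeFn_linftyToL1 (ι (Rn n v)), hwae] with y h1 h2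
    rw [h1, h2]
    by_cases hy : y ∈ s <;> simp [hy]
  have hr : ∫ y, cutoff μ hφ n (linftyToL1 μ (ι v)) y * w (F y) ∂μ =
      ∫ y in φ ⁻¹' {n} ∩ F ⁻¹' s, ι v y ∂μ := by
    rw [← integral_indicator (hφn.inter (hF.measurable hs))]
    have hc : cutoff μ hφ n (linftyToL1 μ (ι v)) =ᵐ[μ]
        Set.indicator (φ ⁻¹' {n}) (linftyToL1 μ (ι v)) := MemLp.coeFn_toLp _
    refine integral_congr_ae ?_
    filter_upwards [hc, hwF, coeFn_linftyToL1 (ι v)] with y h1 h2 h3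
    rw [h1, h2]
    by_cases hy : φ y = n <;> by_cases hy' : F y ∈ s <;> simp [hy, hy', h3]
  rw [← hl, key, hr]

theorem hasSum_setIntegral_transfer_cutoff (hF : MeasurePreserving F μ μ) (hφ : Measurable φ)
    (hφ_pos : ∀ y, 1 ≤ φ y) (hR : IsTransferOperator μ F R)
    (hRn : ∀ n : ℕ, 1 ≤ n → ∀ v : B,
      linftyToL1 μ (ι (Rn n v)) = R (cutoff μ hφ n (linftyToL1 μ (ι v))))
    {s : Set Y} (hs : MeasurableSet s) (v : B) :
    HasSum (fun k : ℕ => ∫ y in s, ι (Rn (k + 1) v) y ∂μ) (∫ y in F ⁻¹' s, ι v y ∂μ) := by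
  have hU : ⋃ k : ℕ, φ ⁻¹' {k + 1} ∩ F ⁻¹' s = F ⁻¹' s := by
    ext y
    simp only [Set.mem_iUnion, Set.mem_inter_iff, Set.mem_preimage, Set.mem_singleton_iff]
    exact ⟨fun ⟨_, h⟩ => h.2, fun h => ⟨φ y - 1, by have := hφ_pos y; omega, h⟩⟩
  have h := hasSum_integral_iUnion (μ := μ) (f := ι v) (s := fun k : ℕ => φ ⁻¹' {k + 1} ∩ F ⁻¹' s)
    (fun k => (hφ (measurableSet_singleton _)).inter (hF.measurable hs))
    (fun i j hij => Set.disjoint_left.2 fun y hi hj => hij (by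
      have h1 : φ y = i + 1 := hi.1
      have h2 : φ y = j + 1 := hj.1
      omega))
    (integrable_coe_linfty _).integrableOn
  rw [hU] at h
  exact h.congr_fun fun k =>
    setIntegral_transfer_cutoff hF hφ hR hRn hs (by omega) v

theorem setIntegral_renewalSeries_one [CompleteSpace B] (hF : MeasurePreserving F μ μ)
    (hφ : Measurable φ) (hφ_pos : ∀ y, 1 ≤ φ y) (hR : IsTransferOperator μ F R)
    (hι_norm : ∀ v : B, ‖ι v‖ ≤ ‖v‖)
    (hRn : ∀ n : ℕ, 1 ≤ n → ∀ v : B,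
      linftyToL1 μ (ι (Rn n v)) = R (cutoff μ hφ n (linftyToL1 μ (ι v))))
    (hsum : Summable fun n => ‖Rn (n + 1)‖) {s : Set Y} (hs : MeasurableSet s) (v : B) :
    ∫ y in s, ι (renewalSeries Rn 1 v) y ∂μ = ∫ y in F ⁻¹' s, ι v y ∂μ := by
  have h1 := hasSum_setIntegral_transfer_cutoff hF hφ hφ_pos hR hRn hs v
  have h2 := (hasSum_renewalSeries hsum (z := 1) (by simp)).mapL
    (setIntegralFunctional ι hι_norm s ∘L ContinuousLinearMap.apply ℂ B v)
  refine h2.unique (h1.congr_fun fun k => ?_)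
  simp [setIntegralFunctional_apply]

end TransferFunctionals

theorem tendsto_tail_ratio {a l : ℕ → ℝ} {β : ℝ} (ha : ∀ n : ℕ, 1 ≤ n → a n = l n * (n : ℝ) ^ (-β))
    (hl : Tendsto (fun n => l (2 * n) / l n) atTop (𝓝 1)) :
    Tendsto (fun n => a (2 * n) / a n) atTop (𝓝 ((2 : ℝ) ^ (-β))) := by
  have h := hl.mul_const ((2 : ℝ) ^ (-β))
  rw [one_mul] at h
  refine h.congr' ?_
  filter_upwards [eventually_ge_atTop 1] with n hn
  have hn0 : (0 : ℝ) < n := by exact_mod_cast hn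
  have hp : (0 : ℝ) < (n : ℝ) ^ (-β) := by positivity
  rw [ha n hn, ha (2 * n) (by omega)]
  push_cast
  rw [Real.mul_rpow (by norm_num) hn0.le, ← mul_assoc, mul_div_mul_right _ _ hp.ne',
    mul_div_right_comm]

theorem operator_renewal_upper_bound_beta_lt_half
    {Y : Type*} [MeasurableSpace Y] (μ : Measure Y) [IsProbabilityMeasure μ]
    (F : Y → Y) (hF : MeasurePreserving F μ μ)
    (φ : Y → ℕ) (hφ : Measurable φ) (hφ_pos : ∀ y, 1 ≤ φ y)
    (l : ℝ → ℝ) (hl : SlowlyVarying l) (β : ℝ) (hβ_pos : 0 < β) (hβ_lt : β < 1 / 2)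
    (h_tail : ∀ n : ℕ, 1 ≤ n → μ.real {y | n < φ y} = l n * (n : ℝ) ^ (-β))
    -- the transfer operator of `F` on `L¹`
    (R : Lp ℂ 1 μ →L[ℂ] Lp ℂ 1 μ) (hR : IsTransferOperator μ F R)
    -- the Banach space `B ⊆ L^∞`, with inclusion `ι`
    {B : Type*} [NormedAddCommGroup B] [NormedSpace ℂ B] [CompleteSpace B]
    (ι : B →ₗ[ℂ] Lp ℂ ∞ μ) (hι_inj : Function.Injective ι)
    (hι_norm : ∀ v : B, ‖ι v‖ ≤ ‖v‖)
    (hι_one : ∀ c : ℂ, ∃ v : B, ι v = Lp.const ∞ μ c)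
    -- (H1): `R_n v = R (1_{φ = n} v)` defines bounded operators on `B`, with the norm bound
    (Rn : ℕ → B →L[ℂ] B)
    (hRn : ∀ n : ℕ, 1 ≤ n → ∀ v : B,
      linftyToL1 μ (ι (Rn n v)) = R (cutoff μ hφ n (linftyToL1 μ (ι v))))
    (hH1 : ∃ C : ℝ, 0 < C ∧ ∀ n : ℕ, 1 ≤ n → ‖Rn n‖ ≤ C * μ.real {y | φ y = n})
    -- (H2)
    (hH2i : IsSimpleIsolatedEigenvalue (renewalSeries Rn 1) 1)
    (hH2ii : ∀ z : ℂ, ‖z‖ ≤ 1 → z ≠ 1 → (1 : ℂ) ∉ spectrum ℂ (renewalSeries Rn z)) :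
    ∃ C' : ℝ, 0 < C' ∧
      ∀ n : ℕ, 1 ≤ n → ‖renewalOp Rn n‖ ≤ C' * (l n * (n : ℝ) ^ (-β)) := by
  obtain ⟨C, hC, hRnC⟩ := hH1
  obtain ⟨e, he⟩ := hι_one 1
  set a : ℕ → ℝ := fun n => μ.real {y | n < φ y} with ha_def
  have hmeas : ∀ n, MeasurableSet {y | n < φ y} := fun n => measurableSet_lt measurable_const hφ
  have ha : Antitone a := fun i j hij =>
    measureReal_mono fun y (hy : j < φ y) => lt_of_le_of_lt hij hy
  have ha0 : a 0 = 1 := by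
    have : {y | 0 < φ y} = Set.univ := Set.eq_univ_of_forall fun y => hφ_pos y
    simp only [ha_def, this, probReal_univ]
  have hpos : ∀ n, 0 < a n := by
    intro n
    rcases Nat.eq_zero_or_pos n with rfl | hn
    · rw [ha0]; exact one_pos
    · have hn0 : (0 : ℝ) < n := by exact_mod_cast hn
      have : a n = l n * (n : ℝ) ^ (-β) := h_tail n hn
      rw [this]
      exact mul_pos (hl.1 n hn0) (by positivity)
  have hdiff : ∀ k, μ.real {y | φ y = k + 1} = a k - a (k + 1) := by
    intro k
    have hsub : {y | k + 1 < φ y} ⊆ {y | k < φ y} := fun y (hy : k + 1 < φ y) =>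
      show k < φ y by omega
    have : {y | φ y = k + 1} = {y | k < φ y} \ {y | k + 1 < φ y} := by
      ext y; simp only [Set.mem_ofPred_eq, Set.mem_sdiff]; omega
    rw [this, measureReal_sdiff hsub (hmeas _)]
  have hlim : Tendsto (fun n => a (2 * n) / a n) atTop (𝓝 ((2 : ℝ) ^ (-β))) := by
    refine tendsto_tail_ratio (l := fun n => l n) h_tail ?_
    have := (hl.2.2.2 2 two_pos).comp tendsto_natCast_atTop_atTop
    refine this.congr fun n => ?_
    simp
  have hRn' : ∀ k, ‖Rn (k + 1)‖ ≤ C * (a k - a (k + 1)) := fun k => by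
    rw [← hdiff]; exact hRnC (k + 1) (by omega)
  have hsum : Summable fun n => ‖Rn (n + 1)‖ :=
    ((summable_sub_succ_of_antitone ha hpos).mul_left C).of_nonneg_of_le
      (fun _ => norm_nonneg _) hRn'
  set m := setIntegralFunctional ι hι_norm Set.univ with hm
  have hmR : ∀ k v, m (Rn (k + 1) v) = ∫ y in φ ⁻¹' {k + 1}, ι v y ∂μ := by
    intro k v
    rw [hm, setIntegralFunctional_apply,
      setIntegral_transfer_cutoff hF hφ hR hRn MeasurableSet.univ (by omega), Set.preimage_univ,
      Set.inter_univ]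
  have hφk : ∀ k, μ.real (φ ⁻¹' {k + 1}) = a k - a (k + 1) := hdiff
  have heae : ι e =ᵐ[μ] fun _ => (1 : ℂ) := by rw [he]; exact Lp.coeFn_const _ _ _
  have heint : ∀ s : Set Y, ∫ y in s, ι e y ∂μ = (μ.real s : ℂ) := by
    intro s
    rw [integral_congr_ae (ae_restrict_of_ae heae)]
    simp
  have hAe : renewalSeries Rn 1 e = e := by
    refine hι_inj (Lp.ext ?_)
    refine Integrable.ae_eq_of_forall_setIntegral_eq _ _ (integrable_coe_linfty _)
      (integrable_coe_linfty _) fun s hs _ => ?_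
    rw [setIntegral_renewalSeries_one hF hφ hφ_pos hR hι_norm hRn hsum hs, heint, heint,
      measureReal_def, measureReal_def, hF.measure_preimage hs.nullMeasurableSet]
  have hfinal := exists_norm_renewalOp_le (Rn := Rn) (e := e) (m := m) ha hpos hβ_pos hβ_lt hlim hC
    hRn' (fun k v => ?_) (fun k => ?_) (fun v => ?_) ?_ hAe hH2i fun z hz hz1 => ?_
  · obtain ⟨C', hC', hle⟩ := hfinal
    refine ⟨C', hC', fun n hn => ?_⟩
    rw [← h_tail n hn]
    exact hle n hn
  · rw [hmR, ← hφk]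
    exact (norm_setIntegral_linfty_le _ _).trans
      (mul_le_mul_of_nonneg_left (hι_norm v) measureReal_nonneg)
  · rw [hmR, heint, hφk]
  · rw [hm, setIntegralFunctional_apply, setIntegralFunctional_apply,
      setIntegral_renewalSeries_one hF hφ hφ_pos hR hι_norm hRn hsum MeasurableSet.univ,
      Set.preimage_univ]
  · rw [hm, setIntegralFunctional_apply, heint, probReal_univ, Complex.ofReal_one]
  · have := hH2ii z hz hz1
    rw [spectrum.notMem_iff, map_one] at this
    exact this
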